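/- arXiv:2401.00749 — 10 statements merged into one kernel-verified Lean document; each statement's English description precedes it below -/
import Mathlib

section
/- Let p < −1/2 and a, b > 0. For every x > 0, the GIG density satisfies f_{p,a,b}(x) = ∫₀^∞ f_IG(x; √(b/(a+2y)), b) · h₀(y) dy, where h₀(y) = (1/Z₀) · y^{−(p+3/2)} · exp(−√(b(a+2y))) for y > 0 and Z₀ = √b · Γ(−p−1/2) · Z(p,a,b)/√(2π). (This expresses the GIG(p,a,b) as a continuous mixture of inverse Gaussian distributions, case p < −1/2 of Proposition 1.) -/
open Real MeasureTheory Set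

/-- The (unnormalized) kernel of the GIG(p,a,b) distribution. -/
noncomputable def gigKernel (p a b x : ℝ) : ℝ :=
  x ^ (p - 1) * Real.exp (-((a * x + b / x) / 2))

/-- The normalizing constant Z(p,a,b) of the GIG(p,a,b) distribution. -/
noncomputable def gigZ (p a b : ℝ) : ℝ :=
  ∫ x in Ioi (0 : ℝ), gigKernel p a b x

/-- The probability density function of the GIG(p,a,b) distribution. -/
noncomputable def gigPdf (p a b x : ℝ) : ℝ :=
  gigKernel p a b x / gigZ p a b

/-- The inverse Gaussian InvGauss(μ,λ) density. -/
noncomputable def invGaussPdf (μ lam x : ℝ) : ℝ :=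
  Real.sqrt (lam / (2 * Real.pi * x ^ 3)) *
    Real.exp (-(lam * (x - μ) ^ 2) / (2 * μ ^ 2 * x))

/-- The Gamma(α,β) density (shape α, rate β). -/
noncomputable def gammaPdf (α β y : ℝ) : ℝ :=
  β ^ α * y ^ (α - 1) * Real.exp (-(β * y)) / Real.Gamma α

/-- The inverse Gaussian density with mean `√(b / c)` and shape `b`, as a tilted kernel. -/
theorem invGaussPdf_sqrt_div_mul_exp {b c x : ℝ} (hb : 0 < b) (hc : 0 < c) (hx : 0 < x) :
    invGaussPdf (Real.sqrt (b / c)) b x * Real.exp (-Real.sqrt (b * c)) =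
      Real.sqrt (b / (2 * Real.pi * x ^ 3)) * Real.exp (-((c * x + b / x) / 2)) := by
  have hμ : Real.sqrt (b / c) = b / Real.sqrt (b * c) := by
    rw [show b / c = b ^ 2 / (b * c) by field_simp, Real.sqrt_div (sq_nonneg b),
      Real.sqrt_sq hb.le]
  have hs : 0 < Real.sqrt (b * c) := Real.sqrt_pos.2 (mul_pos hb hc)
  have hs2 : Real.sqrt (b * c) ^ 2 = b * c := Real.sq_sqrt (mul_pos hb hc).le
  rw [invGaussPdf, hμ, mul_assoc, ← Real.exp_add]
  congr 2
  generalize Real.sqrt (b * c) = s at hs hs2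
  obtain rfl : c = s ^ 2 / b := by rw [hs2]; field_simp
  field_simp
  ring

theorem sqrt_div_two_pi_mul_cube {b x : ℝ} (hb : 0 < b) (hx : 0 < x) :
    Real.sqrt (b / (2 * Real.pi * x ^ 3)) =
      Real.sqrt b / Real.sqrt (2 * Real.pi) * x ^ (-(3 / 2) : ℝ) := by
  rw [Real.sqrt_div hb.le, Real.sqrt_mul (by positivity), Real.rpow_neg hx.le,
    Real.sqrt_eq_rpow (x ^ 3), ← Real.rpow_natCast_mul hx.le]
  norm_num
  ring

/-- Proposition 1 (case p < -1/2): the GIG(p,a,b) density is a continuous mixture of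
inverse Gaussian densities, with mixing density
h₀(y) = (1/Z₀) y^{-(p+3/2)} exp(-√(b(a+2y))), Z₀ = √b Γ(-p-1/2) Z(p,a,b)/√(2π). -/
theorem gig_invGauss_mixture_neg (p a b : ℝ) (hp : p < -(1/2 : ℝ)) (ha : 0 < a) (hb : 0 < b)
    (x : ℝ) (hx : 0 < x) :
    gigPdf p a b x =
      ∫ y in Ioi (0 : ℝ),
        invGaussPdf (Real.sqrt (b / (a + 2 * y))) b x *
          (1 / (Real.sqrt b * Real.Gamma (-p - 1/2) * gigZ p a b / Real.sqrt (2 * Real.pi)) *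
            y ^ (-(p + 3/2)) * Real.exp (-Real.sqrt (b * (a + 2 * y)))) := by
  have hα : 0 < -p - 1 / 2 := by linarith
  set C := 1 / (Real.sqrt b * Real.Gamma (-p - 1/2) * gigZ p a b / Real.sqrt (2 * Real.pi))
    with hC
  have hint : ∀ y ∈ Ioi (0 : ℝ),
      invGaussPdf (Real.sqrt (b / (a + 2 * y))) b x *
          (C * y ^ (-(p + 3/2)) * Real.exp (-Real.sqrt (b * (a + 2 * y)))) =
        (C * Real.sqrt (b / (2 * Real.pi * x ^ 3)) * Real.exp (-((a * x + b / x) / 2))) *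
          (y ^ ((-p - 1 / 2) - 1) * Real.exp (-(x * y))) := by
    intro y hy
    have hy : 0 < y := hy
    have h := invGaussPdf_sqrt_div_mul_exp hb (show 0 < a + 2 * y by positivity) hx
    have hexp : Real.exp (-(((a + 2 * y) * x + b / x) / 2)) =
        Real.exp (-((a * x + b / x) / 2)) * Real.exp (-(x * y)) := by
      rw [← Real.exp_add]
      congr 1
      ring
    rw [hexp] at h
    rw [show (-p - 1 / 2) - 1 = -(p + 3 / 2) by ring]
    linear_combination C * y ^ (-(p + 3 / 2)) * h
  rw [setIntegral_congr_fun measurableSet_Ioi hint, integral_const_mul,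
    Real.integral_rpow_mul_exp_neg_mul_Ioi hα hx, sqrt_div_two_pi_mul_cube hb hx]
  have hpow : x ^ (p - 1) = x ^ (-(3 / 2) : ℝ) * (1 / x) ^ (-p - 1 / 2) := by
    rw [one_div, Real.inv_rpow hx.le, ← Real.rpow_neg hx.le, ← Real.rpow_add hx]
    congr 1
    ring
  have hΓ : Real.Gamma (-p - 1 / 2) ≠ 0 := (Real.Gamma_pos_of_pos hα).ne'
  have hsb : Real.sqrt b ≠ 0 := (Real.sqrt_pos.2 hb).ne'
  have hsπ : Real.sqrt (2 * Real.pi) ≠ 0 := (Real.sqrt_pos.2 (by positivity)).ne'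
  have hCZ : C * (Real.sqrt b / Real.sqrt (2 * Real.pi)) * Real.Gamma (-p - 1 / 2) =
      (gigZ p a b)⁻¹ := by
    rw [hC]
    generalize Real.sqrt (2 * Real.pi) = t at hsπ
    generalize Real.Gamma (-p - 1 / 2) = g at hΓ
    field_simp
  rw [gigPdf, gigKernel, hpow, div_eq_mul_inv, ← hCZ]
  ring
end

section
/- Let p > −1/2 and a, b > 0. For every x > 0, the GIG density satisfies f_{p,a,b}(x) = ∫₀^∞ f_IG(x; √((b+2y)/a), b+2y) · h₁(y) dy, where h₁(y) = (1/Z₁) · y^{p−1/2} · (b+2y)^{−1/2} · exp(−√(a(b+2y))) for y > 0 and Z₁ = Γ(p+1/2) · Z(p,a,b)/√(2π). (This expresses the GIG(p,a,b) as a continuous mixture of inverse Gaussian distributions, case p > −1/2 of Proposition 1.) -/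
open Real MeasureTheory Set

/-- The exponential tilt by `-√(a * l)` cancels the linear term in the exponent of the inverse
Gaussian density with mean `√(l / a)` and shape `l`. -/
lemma invGauss_exponent_sub_sqrt {a l x : ℝ} (ha : 0 < a) (hl : 0 < l) (hx : 0 < x) :
    -(l * (x - √(l / a)) ^ 2) / (2 * √(l / a) ^ 2 * x) + -√(a * l) =
      -(a * x + l / x) / 2 := by
  have hmul : √(a * l) = a * √(l / a) := by
    rw [show a * l = a ^ 2 * (l / a) by field_simp, Real.sqrt_mul (by positivity),
      Real.sqrt_sq ha.le]
  have hsq : √(l / a) ^ 2 = l / a := Real.sq_sqrt (by positivity)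
  have hl' : l = a * √(l / a) ^ 2 := by rw [hsq]; field_simp
  have hm : 0 < √(l / a) := by positivity
  rw [hmul]
  generalize √(l / a) = m at hl' hm
  subst hl'
  field_simp
  ring

/-- The scale factor of the inverse Gaussian density, with the shape parameter divided out. -/
lemma sqrt_div_two_pi_mul_rpow {l x : ℝ} (hl : 0 < l) (hx : 0 < x) :
    √(l / (2 * π * x ^ 3)) * l ^ (-(1 / 2 : ℝ)) = x ^ (-(3 / 2 : ℝ)) / √(2 * π) := by
  have hx3 : √(x ^ 3) = x ^ (3 / 2 : ℝ) := by
    rw [Real.sqrt_eq_rpow, ← Real.rpow_natCast, ← Real.rpow_mul hx.le]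
    norm_num
  have hl0 : √l ≠ 0 := by positivity
  rw [Real.sqrt_div hl.le, Real.sqrt_mul (by positivity), hx3, Real.rpow_neg hl.le,
    ← Real.sqrt_eq_rpow, Real.rpow_neg hx.le]
  field_simp

/-- The inverse Gaussian density tilted by the mixing weight is a Gamma kernel in `y`. -/
lemma invGaussPdf_mul_tilt {a b x y : ℝ} (ha : 0 < a) (hb : 0 < b) (hx : 0 < x) (hy : 0 < y) :
    invGaussPdf √((b + 2 * y) / a) (b + 2 * y) x *
        ((b + 2 * y) ^ (-(1 / 2 : ℝ)) * Real.exp (-√(a * (b + 2 * y)))) =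
      x ^ (-(3 / 2 : ℝ)) / √(2 * π) * Real.exp (-((a * x + b / x) / 2)) *
        Real.exp (-(x⁻¹ * y)) := by
  have hl : 0 < b + 2 * y := by positivity
  rw [invGaussPdf, mul_mul_mul_comm, sqrt_div_two_pi_mul_rpow hl hx, ← Real.exp_add,
    invGauss_exponent_sub_sqrt ha hl hx, mul_assoc _ (Real.exp _), ← Real.exp_add]
  congr 2
  field_simp
  ring

/-- Proposition 1 (case p > -1/2): the GIG(p,a,b) density is a continuous mixture of
inverse Gaussian densities, with mixing density
h₁(y) = (1/Z₁) y^{p-1/2} (b+2y)^{-1/2} exp(-√(a(b+2y))), Z₁ = Γ(p+1/2) Z(p,a,b)/√(2π). -/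
theorem gig_invGauss_mixture_pos (p a b : ℝ) (hp : -(1/2 : ℝ) < p) (ha : 0 < a) (hb : 0 < b)
    (x : ℝ) (hx : 0 < x) :
    gigPdf p a b x =
      ∫ y in Ioi (0 : ℝ),
        invGaussPdf (Real.sqrt ((b + 2 * y) / a)) (b + 2 * y) x *
          (1 / (Real.Gamma (p + 1/2) * gigZ p a b / Real.sqrt (2 * Real.pi)) *
            (y ^ (p - 1/2) * (b + 2 * y) ^ (-(1/2 : ℝ)) *
              Real.exp (-Real.sqrt (a * (b + 2 * y))))) := by
  have hΓ : Real.Gamma (p + 1 / 2) ≠ 0 := (Real.Gamma_pos_of_pos (by linarith)).ne'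
  have hπ : √(2 * π) ≠ 0 := by positivity
  have hmix : ∀ y ∈ Ioi (0 : ℝ),
      invGaussPdf √((b + 2 * y) / a) (b + 2 * y) x *
          (1 / (Real.Gamma (p + 1 / 2) * gigZ p a b / √(2 * π)) *
            (y ^ (p - 1 / 2) * (b + 2 * y) ^ (-(1 / 2 : ℝ)) *
              Real.exp (-√(a * (b + 2 * y))))) =
        x ^ (-(3 / 2 : ℝ)) * Real.exp (-((a * x + b / x) / 2)) /
            (Real.Gamma (p + 1 / 2) * gigZ p a b) *
          (y ^ (p + 1 / 2 - 1) * Real.exp (-(x⁻¹ * y))) := by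
    intro y hy
    rw [show p + 1 / 2 - 1 = p - 1 / 2 by ring, one_div_div]
    calc _ = √(2 * π) / (Real.Gamma (p + 1 / 2) * gigZ p a b) * y ^ (p - 1 / 2) *
          (invGaussPdf √((b + 2 * y) / a) (b + 2 * y) x *
            ((b + 2 * y) ^ (-(1 / 2 : ℝ)) * Real.exp (-√(a * (b + 2 * y))))) := by ring
      _ = _ := by
        rw [invGaussPdf_mul_tilt ha hb hx hy]
        field_simp
  rw [setIntegral_congr_fun measurableSet_Ioi hmix, integral_const_mul,
    Real.integral_rpow_mul_exp_neg_mul_Ioi (by linarith) (inv_pos.mpr hx), one_div x⁻¹, inv_inv,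
    gigPdf, gigKernel, show p - 1 = -(3 / 2) + (p + 1 / 2) by ring, Real.rpow_add hx]
  generalize Real.Gamma (p + 1 / 2) = g at hΓ
  field_simp
end

section
/- Let p < −1/2 and a, b > 0. Then ∫₀^∞ y^{−(p+3/2)} · exp(−√(b(a+2y))) dy = √b · Γ(−p−1/2) · Z(p,a,b)/√(2π). (This identifies the normalizing constant Z₀ of the mixing density in Proposition 1, case p < −1/2; equivalently, Z₀ = b^{(p+1)/2} √2 Γ(−p−1/2) K_p(√(ab)) / (a^{p/2} √π).) -/
open Real MeasureTheory Set

/-- Fubini's theorem for almost everywhere nonnegative functions with integrable sections; the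
outer integrals may diverge, in which case both sides vanish. -/
lemma integral_integral_swap_of_nonneg {α β : Type*} [MeasurableSpace α] [MeasurableSpace β]
    {μ : Measure α} {ν : Measure β} [SFinite μ] [SFinite ν] {f : α → β → ℝ}
    (hf : Measurable (Function.uncurry f))
    (hx : ∀ᵐ x ∂μ, Integrable (f x) ν) (hy : ∀ᵐ y ∂ν, Integrable (fun x => f x y) μ)
    (hx0 : ∀ᵐ x ∂μ, ∀ᵐ y ∂ν, 0 ≤ f x y) (hy0 : ∀ᵐ y ∂ν, ∀ᵐ x ∂μ, 0 ≤ f x y) :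
    ∫ x, ∫ y, f x y ∂ν ∂μ = ∫ y, ∫ x, f x y ∂μ ∂ν := by
  have hmx : AEStronglyMeasurable (fun x => ∫ y, f x y ∂ν) μ :=
    hf.stronglyMeasurable.integral_prod_right.aestronglyMeasurable
  have hmy : AEStronglyMeasurable (fun y => ∫ x, f x y ∂μ) ν :=
    hf.stronglyMeasurable.integral_prod_left.aestronglyMeasurable
  rw [integral_eq_lintegral_of_nonneg_ae (hx0.mono fun x h => integral_nonneg_of_ae h) hmx,
    integral_eq_lintegral_of_nonneg_ae (hy0.mono fun y h => integral_nonneg_of_ae h) hmy]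
  congr 1
  calc ∫⁻ x, ENNReal.ofReal (∫ y, f x y ∂ν) ∂μ
      = ∫⁻ x, ∫⁻ y, ENNReal.ofReal (f x y) ∂ν ∂μ := by
        apply lintegral_congr_ae
        filter_upwards [hx, hx0] with x h h0
        exact ofReal_integral_eq_lintegral_ofReal h h0
    _ = ∫⁻ y, ∫⁻ x, ENNReal.ofReal (f x y) ∂μ ∂ν :=
        lintegral_lintegral_swap hf.ennreal_ofReal.aemeasurable
    _ = ∫⁻ y, ENNReal.ofReal (∫ x, f x y ∂μ) ∂ν := by
        apply lintegral_congr_ae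
        filter_upwards [hy, hy0] with y h h0
        exact (ofReal_integral_eq_lintegral_ofReal h h0).symm

lemma hasDerivAt_mul_sub_div (r s : ℝ) {t : ℝ} (ht : t ≠ 0) :
    HasDerivAt (fun t : ℝ => s * t - r / t) (s + r / t ^ 2) t := by
  have h := ((hasDerivAt_id t).const_mul s).sub ((hasDerivAt_inv ht).const_mul r)
  convert! h using 1
  field_simp
  ring

lemma strictMonoOn_mul_sub_div {r s : ℝ} (hr : 0 < r) (hs : 0 < s) :
    StrictMonoOn (fun t : ℝ => s * t - r / t) (Ioi 0) := by
  intro x hx y _ hxy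
  have hx : 0 < x := hx
  have h1 : s * x < s * y := by gcongr
  have h2 : r / y < r / x := by gcongr
  simp only
  linarith

lemma image_mul_sub_div_Ioi {r s : ℝ} (hr : 0 < r) (hs : 0 < s) :
    (fun t : ℝ => s * t - r / t) '' Ioi 0 = univ := by
  refine eq_univ_of_forall fun u => ?_
  have hd : 0 < u ^ 2 + 4 * s * r := by positivity
  have hsq := Real.sq_sqrt hd.le
  have hpos : 0 < u + √(u ^ 2 + 4 * s * r) := by
    have : |u| < √(u ^ 2 + 4 * s * r) := by
      rw [← Real.sqrt_sq_eq_abs]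
      exact Real.sqrt_lt_sqrt (sq_nonneg u) (by nlinarith [mul_pos hs hr])
    linarith [neg_abs_le u]
  refine ⟨(u + √(u ^ 2 + 4 * s * r)) / (2 * s), div_pos hpos (by positivity), ?_⟩
  simp only
  generalize √(u ^ 2 + 4 * s * r) = v at *
  field_simp
  nlinarith

lemma image_const_div_Ioi {c : ℝ} (hc : 0 < c) : (fun t : ℝ => c / t) '' Ioi 0 = Ioi 0 := by
  ext y
  constructor
  · rintro ⟨t, ht, rfl⟩
    exact div_pos hc ht
  · intro hy
    exact ⟨c / y, div_pos hc hy, div_div_cancel₀ hc.ne'⟩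

/-- The Cauchy–Schlömilch transformation of the Gaussian integral. -/
lemma integral_exp_neg_mul_sub_div_sq {r s : ℝ} (hr : 0 < r) (hs : 0 < s) :
    ∫ t in Ioi (0 : ℝ), rexp (-(s * t - r / t) ^ 2 / 2) = √(2 * π) / (2 * s) := by
  set F : ℝ → ℝ := fun t => rexp (-(s * t - r / t) ^ 2 / 2) with hF
  have hderiv : ∀ t ∈ Ioi (0 : ℝ),
      HasDerivWithinAt (fun t : ℝ => s * t - r / t) (s + r / t ^ 2) (Ioi 0) t :=
    fun t ht => (hasDerivAt_mul_sub_div r s (ne_of_gt ht)).hasDerivWithinAt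
  have hinj := (strictMonoOn_mul_sub_div hr hs).injOn
  have habs : ∀ t ∈ Ioi (0 : ℝ), |s + r / t ^ 2| • F t = s * F t + r / t ^ 2 * F t := by
    intro t ht
    have ht : 0 < t := ht
    rw [abs_of_pos (by positivity), smul_eq_mul, add_mul]
  have hgauss : ∀ u : ℝ, rexp (-u ^ 2 / 2) = rexp (-(1 / 2) * u ^ 2) := fun u => by
    congr 1; ring
  have hsum_int : IntegrableOn (fun t => s * F t + r / t ^ 2 * F t) (Ioi 0) := by
    refine IntegrableOn.congr_fun ?_ habs measurableSet_Ioi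
    refine (integrableOn_image_iff_integrableOn_abs_deriv_smul measurableSet_Ioi hderiv hinj
      (fun u => rexp (-u ^ 2 / 2))).1 ?_
    rw [image_mul_sub_div_Ioi hr hs, integrableOn_univ]
    simp_rw [hgauss]
    exact integrable_exp_neg_mul_sq (by norm_num)
  have hsum : ∫ t in Ioi (0 : ℝ), (s * F t + r / t ^ 2 * F t) = √(2 * π) := by
    rw [← setIntegral_congr_fun measurableSet_Ioi habs]
    have := integral_image_eq_integral_abs_deriv_smul measurableSet_Ioi hderiv hinj
      (fun u => rexp (-u ^ 2 / 2))
    rw [← this, image_mul_sub_div_Ioi hr hs, setIntegral_univ]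
    simp_rw [hgauss]
    rw [integral_gaussian]
    congr 1
    ring
  have hFm : Measurable F := by fun_prop
  have hF0 : ∀ t, 0 ≤ F t := fun t => (Real.exp_pos _).le
  have hint₁ : IntegrableOn (fun t => s * F t) (Ioi 0) := by
    refine Integrable.mono' hsum_int (by fun_prop) (Filter.Eventually.of_forall fun t => ?_)
    rw [Real.norm_of_nonneg (mul_nonneg hs.le (hF0 t))]
    have : 0 ≤ r / t ^ 2 * F t := mul_nonneg (by positivity) (hF0 t)
    linarith
  have hint₂ : IntegrableOn (fun t => r / t ^ 2 * F t) (Ioi 0) := by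
    have := hsum_int.sub hint₁
    simpa [Pi.sub_def] using this
  have hrefl : ∫ t in Ioi (0 : ℝ), s * F t = ∫ t in Ioi (0 : ℝ), r / t ^ 2 * F t := by
    have hc : 0 < r / s := div_pos hr hs
    have hd : ∀ t ∈ Ioi (0 : ℝ),
        HasDerivWithinAt (fun t : ℝ => r / s / t) (-(r / s / t ^ 2)) (Ioi 0) t := by
      intro t ht
      have h := (hasDerivAt_inv (ne_of_gt ht)).const_mul (r / s)
      convert! h.hasDerivWithinAt using 1
      ring
    have hi : InjOn (fun t : ℝ => r / s / t) (Ioi 0) := by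
      intro x _ y _ hxy
      simpa [div_eq_mul_inv, hr.ne', hs.ne'] using hxy
    have := integral_image_eq_integral_abs_deriv_smul measurableSet_Ioi hd hi (fun t => s * F t)
    rw [image_const_div_Ioi hc] at this
    rw [this]
    refine setIntegral_congr_fun measurableSet_Ioi fun t ht => ?_
    have ht : 0 < t := ht
    have hFt : F (r / s / t) = F t := by
      simp only [hF]
      congr 1
      field_simp
      ring
    simp only [hFt, smul_eq_mul]
    rw [abs_neg, abs_of_pos (by positivity)]
    field_simp
  rw [integral_add hint₁ hint₂, ← hrefl, integral_const_mul] at hsum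
  rw [eq_div_iff (by positivity)]
  linarith

lemma gigZ_neg_half {a b : ℝ} (ha : 0 < a) (hb : 0 < b) :
    gigZ (-1 / 2) a b = √(2 * π) / √b * rexp (-√(b * a)) := by
  have hsub := integral_comp_rpow_Ioi (fun t => rexp (-(√b * t - √a / t) ^ 2 / 2))
    (p := -1 / 2) (by norm_num)
  rw [integral_exp_neg_mul_sub_div_sq (Real.sqrt_pos.2 ha) (Real.sqrt_pos.2 hb)] at hsub
  have hker : ∀ x ∈ Ioi (0 : ℝ),
      (|(-1 / 2 : ℝ)| * x ^ ((-1 / 2 : ℝ) - 1)) •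
        rexp (-(√b * x ^ (-1 / 2 : ℝ) - √a / x ^ (-1 / 2 : ℝ)) ^ 2 / 2)
      = rexp (√(b * a)) / 2 * gigKernel (-1 / 2) a b x := by
    intro x hx
    have hx : 0 < x := hx
    have hpow : x ^ (-1 / 2 : ℝ) = (√x)⁻¹ := by
      rw [neg_div, Real.rpow_neg hx.le, Real.sqrt_eq_rpow]
    have hexp : -(√b * (√x)⁻¹ - √a / (√x)⁻¹) ^ 2 / 2
        = √(b * a) + -((a * x + b / x) / 2) := by
      rw [Real.sqrt_mul hb.le]
      have hx' := Real.sqrt_pos.2 hx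
      have : a * x + b / x = √a ^ 2 * √x ^ 2 + √b ^ 2 / √x ^ 2 := by
        rw [Real.sq_sqrt hx.le, Real.sq_sqrt ha.le, Real.sq_sqrt hb.le]
      rw [this]
      field_simp
      ring
    rw [hpow, hexp, Real.exp_add, gigKernel, smul_eq_mul,
      show |(-1 / 2 : ℝ)| = 1 / 2 by norm_num [abs_of_neg]]
    ring
  rw [setIntegral_congr_fun measurableSet_Ioi hker, integral_const_mul] at hsub
  rw [gigZ, Real.exp_neg]
  have h := Real.exp_pos √(b * a)
  have hb' := Real.sqrt_pos.2 hb
  field_simp at hsub ⊢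
  linarith

lemma gigKernel_nonneg (p a b : ℝ) {x : ℝ} (hx : 0 ≤ x) : 0 ≤ gigKernel p a b x :=
  mul_nonneg (Real.rpow_nonneg hx _) (Real.exp_pos _).le

lemma integrableOn_gigKernel_neg_half {a b : ℝ} (ha : 0 < a) (hb : 0 < b) :
    IntegrableOn (gigKernel (-1 / 2) a b) (Ioi 0) := by
  refine Integrable.of_integral_ne_zero ?_
  change gigZ (-1 / 2) a b ≠ 0
  rw [gigZ_neg_half ha hb]
  positivity

lemma integrableOn_rpow_mul_exp_neg_mul {q x : ℝ} (hq : 0 < q) (hx : 0 < x) :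
    IntegrableOn (fun y : ℝ => y ^ (q - 1) * rexp (-(x * y))) (Ioi 0) := by
  refine Integrable.of_integral_ne_zero ?_
  rw [Real.integral_rpow_mul_exp_neg_mul_Ioi hq hx]
  have := Real.Gamma_pos_of_pos hq
  positivity

/-- The normalizing constant Z₀ of the mixing density in Proposition 1, case p < -1/2. -/
theorem gig_mixing_normalizer_neg (p a b : ℝ) (hp : p < -(1/2 : ℝ)) (ha : 0 < a) (hb : 0 < b) :
    ∫ y in Ioi (0 : ℝ), y ^ (-(p + 3/2)) * Real.exp (-Real.sqrt (b * (a + 2 * y)))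
      = Real.sqrt b * Real.Gamma (-p - 1/2) * gigZ p a b / Real.sqrt (2 * Real.pi) := by
  have hq : 0 < -p - 1 / 2 := by linarith
  set q := -p - 1 / 2 with hqdef
  have hsb := Real.sqrt_pos.2 hb
  have hsplit : ∀ x y : ℝ, y ^ (q - 1) * gigKernel (-1 / 2) (a + 2 * y) b x
      = gigKernel (-1 / 2) a b x * (y ^ (q - 1) * rexp (-(x * y))) := by
    intro x y
    have : rexp (-(((a + 2 * y) * x + b / x) / 2))
        = rexp (-((a * x + b / x) / 2)) * rexp (-(x * y)) := by
      rw [← Real.exp_add]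
      congr 1
      ring
    rw [gigKernel, gigKernel, this]
    ring
  have hleft : ∀ y ∈ Ioi (0 : ℝ), y ^ (-(p + 3 / 2)) * rexp (-√(b * (a + 2 * y)))
      = √b / √(2 * π) *
        ∫ x in Ioi (0 : ℝ), y ^ (q - 1) * gigKernel (-1 / 2) (a + 2 * y) b x := by
    intro y hy
    have hy : 0 < y := hy
    have h := gigZ_neg_half (add_pos ha (mul_pos two_pos hy)) hb
    rw [gigZ] at h
    rw [integral_const_mul, h, show -(p + 3 / 2) = q - 1 by rw [hqdef]; ring]
    field_simp
  have hright : ∀ x ∈ Ioi (0 : ℝ),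
      ∫ y in Ioi (0 : ℝ), y ^ (q - 1) * gigKernel (-1 / 2) (a + 2 * y) b x
      = Real.Gamma q * gigKernel p a b x := by
    intro x hx
    have hx : 0 < x := hx
    simp_rw [hsplit]
    rw [integral_const_mul, Real.integral_rpow_mul_exp_neg_mul_Ioi hq hx, one_div,
      Real.inv_rpow hx.le, ← Real.rpow_neg hx.le, gigKernel, gigKernel,
      show p - 1 = (-1 / 2 - 1) + -q by rw [hqdef]; ring, Real.rpow_add hx]
    ring
  have hswap : ∫ y in Ioi (0 : ℝ), ∫ x in Ioi (0 : ℝ),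
        y ^ (q - 1) * gigKernel (-1 / 2) (a + 2 * y) b x
      = ∫ x in Ioi (0 : ℝ), ∫ y in Ioi (0 : ℝ),
        y ^ (q - 1) * gigKernel (-1 / 2) (a + 2 * y) b x := by
    have hnonneg : ∀ x ∈ Ioi (0 : ℝ), ∀ y ∈ Ioi (0 : ℝ),
        0 ≤ y ^ (q - 1) * gigKernel (-1 / 2) (a + 2 * y) b x := fun x hx y hy =>
      mul_nonneg (Real.rpow_nonneg (le_of_lt hy) _) (gigKernel_nonneg _ _ _ (le_of_lt hx))
    apply integral_integral_swap_of_nonneg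
    · unfold Function.uncurry gigKernel
      fun_prop
    · filter_upwards [ae_restrict_mem measurableSet_Ioi] with y hy
      exact (integrableOn_gigKernel_neg_half (add_pos ha (mul_pos two_pos hy)) hb).const_mul _
    · filter_upwards [ae_restrict_mem measurableSet_Ioi] with x hx
      simp_rw [hsplit]
      exact (integrableOn_rpow_mul_exp_neg_mul hq hx).const_mul _
    · filter_upwards [ae_restrict_mem measurableSet_Ioi] with y hy
      filter_upwards [ae_restrict_mem measurableSet_Ioi] with x hx using hnonneg x hx y hy
    · filter_upwards [ae_restrict_mem measurableSet_Ioi] with x hx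
      filter_upwards [ae_restrict_mem measurableSet_Ioi] with y hy using hnonneg x hx y hy
  rw [setIntegral_congr_fun measurableSet_Ioi hleft, integral_const_mul, hswap,
    setIntegral_congr_fun measurableSet_Ioi hright, integral_const_mul, gigZ]
  ring
end

section
/- Let p < −1/2 and a, b > 0, and let h₀(y) = (1/Z₀) · y^{−(p+3/2)} · exp(−√(b(a+2y))) with Z₀ = √b · Γ(−p−1/2) · Z(p,a,b)/√(2π). Then for all x > 0 and y > 0, the joint density factorizes in both orders: f_IG(x; √(b/(a+2y)), b) · h₀(y) = f_{p,a,b}(x) · γ(y; −(p+1/2), x). (This establishes Proposition 2, case p < −1/2: given X = x, the auxiliary variable Y is Gamma(−(p+1/2), x)-distributed.) -/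
open Real MeasureTheory Set

theorem sqrt_div_mul_sqrt_div_eq_rpow_mul_rpow (p : ℝ) {b x : ℝ} (hb : 0 < b) (hx : 0 < x) :
    √(b / (2 * π * x ^ 3)) * (√(2 * π) / √b) = x ^ (p - 1) * x ^ (-(p + 1 / 2)) := by
  have h2π : 0 < 2 * π := by positivity
  have hx3 : √(x ^ 3) = x ^ (3 / 2 : ℝ) := by
    rw [Real.sqrt_eq_rpow, ← Real.rpow_natCast, ← Real.rpow_mul hx.le]
    norm_num
  rw [Real.sqrt_div hb.le, Real.sqrt_mul h2π.le, hx3, ← Real.rpow_add hx,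
    show p - 1 + -(p + 1 / 2) = -(3 / 2 : ℝ) by ring, Real.rpow_neg hx.le]
  have hsb : √b ≠ 0 := (Real.sqrt_pos.2 hb).ne'
  have hsπ : √(2 * π) ≠ 0 := (Real.sqrt_pos.2 h2π).ne'
  have hxp : x ^ (3 / 2 : ℝ) ≠ 0 := (Real.rpow_pos_of_pos hx _).ne'
  field_simp

/-- Completing the square in the exponent of the inverse Gaussian density with mean `√(b / c)`. -/
theorem invGauss_exponent_eq {b c x : ℝ} (hb : 0 < b) (hc : 0 < c) (hx : 0 < x) :
    -(b * (x - √(b / c)) ^ 2) / (2 * √(b / c) ^ 2 * x) = √(b * c) - (c * x + b / x) / 2 := by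
  obtain ⟨s, hs, rfl⟩ : ∃ s, 0 < s ∧ s ^ 2 = b := ⟨√b, Real.sqrt_pos.2 hb, Real.sq_sqrt hb.le⟩
  obtain ⟨t, ht, rfl⟩ : ∃ t, 0 < t ∧ t ^ 2 = c := ⟨√c, Real.sqrt_pos.2 hc, Real.sq_sqrt hc.le⟩
  rw [Real.sqrt_div hb.le, Real.sqrt_mul hb.le, Real.sqrt_sq hs.le, Real.sqrt_sq ht.le]
  field_simp
  ring

/-- Proposition 2 (case p < -1/2): the joint density factorizes in both orders, so that
given X = x the auxiliary variable Y is Gamma(-(p+1/2), x)-distributed. -/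
theorem gig_joint_factorization_neg (p a b : ℝ) (hp : p < -(1/2 : ℝ)) (ha : 0 < a) (hb : 0 < b)
    (x y : ℝ) (hx : 0 < x) (hy : 0 < y) :
    invGaussPdf (Real.sqrt (b / (a + 2 * y))) b x *
        (1 / (Real.sqrt b * Real.Gamma (-p - 1/2) * gigZ p a b / Real.sqrt (2 * Real.pi)) *
          y ^ (-(p + 3/2)) * Real.exp (-Real.sqrt (b * (a + 2 * y))))
      = gigPdf p a b x * gammaPdf (-(p + 1/2)) x y := by
  have hc : 0 < a + 2 * y := by positivity
  have hexp : Real.exp (-(b * (x - √(b / (a + 2 * y))) ^ 2) / (2 * √(b / (a + 2 * y)) ^ 2 * x)) *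
      Real.exp (-√(b * (a + 2 * y)))
        = Real.exp (-((a * x + b / x) / 2)) * Real.exp (-(x * y)) := by
    rw [invGauss_exponent_eq hb hc hx, ← Real.exp_add, ← Real.exp_add]
    ring_nf
  have hpow := sqrt_div_mul_sqrt_div_eq_rpow_mul_rpow p hb hx
  have hy' : -(p + 1 / 2) - 1 = -(p + 3 / 2) := by ring
  have hΓ : -p - 1 / 2 = -(p + 1 / 2) := by ring
  rw [invGaussPdf, gigPdf, gigKernel, gammaPdf, hy', hΓ]
  generalize gigZ p a b = Z
  generalize Real.Gamma (-(p + 1 / 2)) = G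
  calc
    _ = (√(b / (2 * π * x ^ 3)) * (√(2 * π) / √b)) *
          (Real.exp (-(b * (x - √(b / (a + 2 * y))) ^ 2) / (2 * √(b / (a + 2 * y)) ^ 2 * x)) *
            Real.exp (-√(b * (a + 2 * y)))) * y ^ (-(p + 3 / 2)) / (G * Z) := by
      simp only [div_eq_mul_inv, mul_inv, inv_inv]
      ring
    _ = _ := by
      rw [hpow, hexp]
      simp only [div_eq_mul_inv, mul_inv]
      ring
end

section
/- Let p > −1/2 and a, b > 0, and let h₁(y) = (1/Z₁) · y^{p−1/2} · (b+2y)^{−1/2} · exp(−√(a(b+2y))) with Z₁ = Γ(p+1/2) · Z(p,a,b)/√(2π). Then for all x > 0 and y > 0, the joint density factorizes in both orders: f_IG(x; √((b+2y)/a), b+2y) · h₁(y) = f_{p,a,b}(x) · γ(y; p+1/2, 1/x). (This establishes Proposition 2, case p > −1/2: given X = x, the auxiliary variable Y is Gamma(p+1/2, 1/x)-distributed.) -/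
open Real MeasureTheory Set

theorem sqrt_div_mul_rpow_neg_half {l x : ℝ} (hl : 0 < l) (hx : 0 < x) :
    √(l / (2 * π * x ^ 3)) * l ^ (-(1 / 2 : ℝ)) * √(2 * π) = x ^ (-(3 / 2) : ℝ) := by
  have hl' : √l ≠ 0 := (Real.sqrt_pos.mpr hl).ne'
  have hpi : √(2 * π) ≠ 0 := (Real.sqrt_pos.mpr (by positivity)).ne'
  have hx3 : √(x ^ 3) = x ^ (3 / 2 : ℝ) := by
    rw [Real.sqrt_eq_rpow, ← Real.rpow_natCast, ← Real.rpow_mul hx.le]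
    norm_num
  have hx3' : x ^ (3 / 2 : ℝ) ≠ 0 := (Real.rpow_pos_of_pos hx _).ne'
  rw [Real.sqrt_div hl.le, Real.sqrt_mul (by positivity), hx3, Real.rpow_neg hl.le,
    ← Real.sqrt_eq_rpow, Real.rpow_neg hx.le]
  field_simp

theorem rpow_mul_one_div_rpow (p : ℝ) {x : ℝ} (hx : 0 < x) :
    x ^ (p - 1) * (1 / x) ^ (p + 1 / 2) = x ^ (-(3 / 2) : ℝ) := by
  rw [one_div x, Real.inv_rpow hx.le, ← Real.rpow_neg hx.le, ← Real.rpow_add hx]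
  ring_nf

theorem invGauss_exponent {a l x : ℝ} (ha : 0 < a) (hl : 0 < l) (hx : 0 < x) :
    -(l * (x - √(l / a)) ^ 2) / (2 * √(l / a) ^ 2 * x)
      = √(a * l) - (a * x + l / x) / 2 := by
  have hsq : √(l / a) ^ 2 = l / a := Real.sq_sqrt (by positivity)
  have hmul : √(a * l) = a * √(l / a) := by
    rw [show a * l = a ^ 2 * (l / a) by field_simp, Real.sqrt_mul (by positivity),
      Real.sqrt_sq ha.le]
  rw [hmul, sub_sq, hsq]
  field_simp
  ring

/-- Proposition 2 (case p > -1/2): the joint density factorizes in both orders, so that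
given X = x the auxiliary variable Y is Gamma(p+1/2, 1/x)-distributed. -/
theorem gig_joint_factorization_pos (p a b : ℝ) (hp : -(1/2 : ℝ) < p) (ha : 0 < a) (hb : 0 < b)
    (x y : ℝ) (hx : 0 < x) (hy : 0 < y) :
    invGaussPdf (Real.sqrt ((b + 2 * y) / a)) (b + 2 * y) x *
        (1 / (Real.Gamma (p + 1/2) * gigZ p a b / Real.sqrt (2 * Real.pi)) *
          (y ^ (p - 1/2) * (b + 2 * y) ^ (-(1/2 : ℝ)) *
            Real.exp (-Real.sqrt (a * (b + 2 * y)))))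
      = gigPdf p a b x * gammaPdf (p + 1/2) (1 / x) y := by
  have hl : 0 < b + 2 * y := by positivity
  have hpow := (sqrt_div_mul_rpow_neg_half hl hx).trans (rpow_mul_one_div_rpow p hx).symm
  have hexp : Real.exp (-((b + 2 * y) * (x - √((b + 2 * y) / a)) ^ 2) /
        (2 * √((b + 2 * y) / a) ^ 2 * x)) * Real.exp (-√(a * (b + 2 * y)))
      = Real.exp (-((a * x + b / x) / 2)) * Real.exp (-(1 / x * y)) := by
    rw [invGauss_exponent ha hl hx, ← Real.exp_add, ← Real.exp_add]
    congr 1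
    field_simp
    ring
  rw [gigPdf, gammaPdf, invGaussPdf, gigKernel, show p + 1 / 2 - 1 = p - 1 / 2 by ring]
  calc
    _ = (√((b + 2 * y) / (2 * π * x ^ 3)) * (b + 2 * y) ^ (-(1 / 2 : ℝ)) * √(2 * π)) *
          (Real.exp (-((b + 2 * y) * (x - √((b + 2 * y) / a)) ^ 2) /
            (2 * √((b + 2 * y) / a) ^ 2 * x)) * Real.exp (-√(a * (b + 2 * y)))) *
          y ^ (p - 1 / 2) / (Real.Gamma (p + 1 / 2) * gigZ p a b) := by
      rw [one_div_div]
      ring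
    _ = _ := by
      rw [hpow, hexp, div_mul_div_comm]
      ring
end

section
/- Let p > 1 and a, b > 0. Then the mixture weight w := (b/a) · Z(p−2,a,b)/Z(p,a,b) (which equals K_{p−2}(√(ab))/K_p(√(ab))) satisfies 0 < w < 1; equivalently, 0 < (b/a) · Z(p−2,a,b) < Z(p,a,b). -/
open Real MeasureTheory Set

lemma gigKernel_pos (p a b : ℝ) {x : ℝ} (hx : 0 < x) : 0 < gigKernel p a b x :=
  mul_pos (rpow_pos_of_pos hx _) (exp_pos _)

/-- The kernel is dominated by a multiple of a Gamma density of arbitrarily shifted shape. -/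
lemma gigKernel_le (p a : ℝ) {b x : ℝ} (hb : 0 < b) (n : ℕ) (hx : 0 < x) :
    gigKernel p a b x ≤
      (n.factorial * (2 / b) ^ n) * (x ^ (p - 1 + n) * exp (-(a / 2) * x)) := by
  have hexp : exp (-(b / (2 * x))) ≤ n.factorial * (2 / b) ^ n * x ^ n := by
    have h := pow_div_factorial_le_exp (b / (2 * x)) (by positivity) n
    have heq : n.factorial * (2 / b) ^ n * x ^ n = ((b / (2 * x)) ^ n / n.factorial)⁻¹ := by
      rw [inv_div, div_eq_mul_inv _ ((b / (2 * x)) ^ n), ← inv_pow, inv_div, mul_assoc,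
        ← mul_pow, div_mul_eq_mul_div]
    rw [heq, exp_neg]
    exact inv_anti₀ (by positivity) h
  calc gigKernel p a b x
      = x ^ (p - 1) * exp (-(a / 2) * x) * exp (-(b / (2 * x))) := by
        rw [gigKernel, mul_assoc, ← exp_add]
        congr 2
        field_simp
        ring
    _ ≤ x ^ (p - 1) * exp (-(a / 2) * x) * (n.factorial * (2 / b) ^ n * x ^ n) := by
        gcongr
    _ = _ := by
        rw [rpow_add hx, rpow_natCast]
        ring

lemma integrableOn_gigKernel (p : ℝ) {a b : ℝ} (ha : 0 < a) (hb : 0 < b) :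
    IntegrableOn (gigKernel p a b) (Ioi 0) := by
  obtain ⟨n, hn⟩ := exists_nat_gt (-p)
  have hG : IntegrableOn (fun x : ℝ ↦ x ^ (p - 1 + n) * exp (-(a / 2) * x)) (Ioi 0) := by
    simpa using integrableOn_rpow_mul_exp_neg_mul_rpow (s := p - 1 + n) (p := 1) (b := a / 2)
      (by linarith) one_pos (by positivity)
  refine (hG.const_mul (n.factorial * (2 / b) ^ n)).mono' ?_ ?_
  · have : Measurable (gigKernel p a b) := by
      unfold gigKernel
      fun_prop
    exact this.aestronglyMeasurable
  · refine (ae_restrict_iff' measurableSet_Ioi).2 (.of_forall fun x hx ↦ ?_)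
    rw [norm_of_nonneg (gigKernel_pos p a b hx).le]
    exact gigKernel_le p a hb n hx

lemma gigZ_pos (p : ℝ) {a b : ℝ} (ha : 0 < a) (hb : 0 < b) : 0 < gigZ p a b := by
  rw [gigZ, setIntegral_pos_iff_support_of_nonneg_ae _ (integrableOn_gigKernel p ha hb)]
  · have hsub : Ioi (0 : ℝ) ⊆ Function.support (gigKernel p a b) ∩ Ioi 0 :=
      fun x hx ↦ ⟨(gigKernel_pos p a b hx).ne', hx⟩
    exact lt_of_lt_of_le (by simp) (measure_mono hsub)
  · exact (ae_restrict_iff' measurableSet_Ioi).2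
      (.of_forall fun x hx ↦ (gigKernel_pos p a b hx).le)

lemma hasDerivAt_gigKernel (p a b : ℝ) {x : ℝ} (hx : 0 < x) :
    HasDerivAt (gigKernel p a b)
      ((p - 1) * gigKernel (p - 1) a b x - a / 2 * gigKernel p a b x
        + b / 2 * gigKernel (p - 2) a b x) x := by
  have hE : HasDerivAt (fun y : ℝ ↦ -((a * y + b / y) / 2)) (-((a - b / x ^ 2) / 2)) x := by
    have h := ((((hasDerivAt_id x).const_mul a).add
      ((hasDerivAt_inv hx.ne').const_mul b)).div_const 2).neg
    refine (h.congr_deriv ?_).congr_of_eventuallyEq (.of_forall fun y ↦ ?_)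
    · ring
    · simp [div_eq_mul_inv]
  refine ((hasDerivAt_rpow_const (p := p - 1) (Or.inl hx.ne')).mul hE.exp).congr_deriv ?_
  have hpow : x ^ (p - 2 - 1) = x ^ (p - 1) / x ^ 2 := by
    rw [show p - 2 - 1 = p - 1 - (2 : ℕ) by push_cast; ring, rpow_sub hx, rpow_natCast]
  simp only [gigKernel, hpow]
  ring

lemma continuousWithinAt_gigKernel_zero {p a b : ℝ} (hp : 1 < p) (ha : 0 ≤ a) (hb : 0 ≤ b) :
    ContinuousWithinAt (gigKernel p a b) (Ici 0) 0 := by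
  have h0 : gigKernel p a b 0 = 0 := by simp [gigKernel, zero_rpow (sub_pos.2 hp).ne']
  have hpow : Filter.Tendsto (fun x : ℝ ↦ x ^ (p - 1)) (nhdsWithin 0 (Ici 0)) (nhds 0) := by
    have h := (continuousAt_rpow_const 0 (p - 1) (Or.inr (sub_pos.2 hp).le)).tendsto
    rw [zero_rpow (sub_pos.2 hp).ne'] at h
    exact h.mono_left nhdsWithin_le_nhds
  rw [ContinuousWithinAt, h0]
  refine squeeze_zero' ?_ ?_ hpow
  · filter_upwards [self_mem_nhdsWithin] with x hx
    exact mul_nonneg (rpow_nonneg hx _) (exp_pos _).le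
  · filter_upwards [self_mem_nhdsWithin] with x (hx : 0 ≤ x)
    refine mul_le_of_le_one_right (rpow_nonneg hx _) (exp_le_one_iff.2 ?_)
    exact neg_nonpos.2 (by positivity)

lemma tendsto_gigKernel_atTop (p : ℝ) {a b : ℝ} (ha : 0 < a) (hb : 0 < b) :
    Filter.Tendsto (gigKernel p a b) Filter.atTop (nhds 0) := by
  refine squeeze_zero' ?_ ?_
    (tendsto_rpow_mul_exp_neg_mul_atTop_nhds_zero (p - 1) (a / 2) (by positivity))
  · filter_upwards [Filter.eventually_gt_atTop 0] with x hx
    exact (gigKernel_pos p a b hx).le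
  · filter_upwards [Filter.eventually_gt_atTop 0] with x hx
    simpa using gigKernel_le p a hb 0 hx

/-- The three-term recurrence for the normalizing constants (integration by parts). -/
lemma gigZ_recurrence {p a b : ℝ} (hp : 1 < p) (ha : 0 < a) (hb : 0 < b) :
    a * gigZ p a b = 2 * (p - 1) * gigZ (p - 1) a b + b * gigZ (p - 2) a b := by
  have h0 : gigKernel p a b 0 = 0 := by simp [gigKernel, zero_rpow (sub_pos.2 hp).ne']
  have i₁ := (integrableOn_gigKernel (p - 1) ha hb).const_mul (p - 1)
  have i₂ := (integrableOn_gigKernel p ha hb).const_mul (a / 2)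
  have i₃ := (integrableOn_gigKernel (p - 2) ha hb).const_mul (b / 2)
  have h := integral_Ioi_of_hasDerivAt_of_tendsto
    (continuousWithinAt_gigKernel_zero hp ha.le hb.le)
    (fun x hx ↦ hasDerivAt_gigKernel p a b hx) ((i₁.sub i₂).add i₃)
    (tendsto_gigKernel_atTop p ha hb)
  rw [integral_add (by exact i₁.sub i₂) i₃, integral_sub i₁ i₂, integral_const_mul, integral_const_mul,
    integral_const_mul, h0] at h
  simp only [gigZ]
  linarith

/-- For p > 1, the mixture weight w = (b/a) Z(p-2,a,b)/Z(p,a,b) lies strictly in (0,1). -/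
theorem gig_mixture_weight_mem_Ioo (p a b : ℝ) (hp : 1 < p) (ha : 0 < a) (hb : 0 < b) :
    0 < (b / a) * gigZ (p - 2) a b / gigZ p a b ∧
      (b / a) * gigZ (p - 2) a b / gigZ p a b < 1 := by
  have hZ := gigZ_pos p ha hb
  have hZ₁ := gigZ_pos (p - 1) ha hb
  have hZ₂ := gigZ_pos (p - 2) ha hb
  refine ⟨by positivity, ?_⟩
  rw [div_lt_one hZ, div_mul_eq_mul_div, div_lt_iff₀ ha, mul_comm (gigZ p a b),
    gigZ_recurrence hp ha hb]
  have := mul_pos (sub_pos.2 hp) hZ₁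
  linarith
end

section
/- Let p > 1 and a, b > 0. Then for every x > 0, x^{p−1} · exp(−(a x + b/x)/2) = ∫₀^x exp(−(a/2)(x−y)) · [ (b/2) · y^{p−3} + (p−1) · y^{p−2} ] · exp(−(a y + b/y)/2) dy. (This is the unnormalized form of the mixture representation of the GIG kernel as a continuous mixture of truncated Exponential(a/2) densities, with the explicit mixing density computed via Theorem 2.4 of Jauch et al. in the proof of Proposition 4.) -/
open Real MeasureTheory Set

/-- The antiderivative in `y` of the truncated exponential mixture integrand. -/
lemma hasDerivAt_rpow_mul_exp_neg_div (p c b : ℝ) {y : ℝ} (hy : 0 < y) :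
    HasDerivAt (fun y : ℝ => y ^ (p - 1) * Real.exp (-((c + b / y) / 2)))
      (((b / 2) * y ^ (p - 3) + (p - 1) * y ^ (p - 2)) * Real.exp (-((c + b / y) / 2))) y := by
  have h₁ : HasDerivAt (fun y : ℝ => y ^ (p - 1)) ((p - 1) * y ^ (p - 1 - 1)) y :=
    Real.hasDerivAt_rpow_const (Or.inl hy.ne')
  have h₂ : HasDerivAt (fun y : ℝ => -((c + b / y) / 2)) (-((b * -(y ^ 2)⁻¹) / 2)) y := by
    simpa only [div_eq_mul_inv] using
      ((((hasDerivAt_inv hy.ne').const_mul b).const_add c).div_const 2).fun_neg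
  refine (h₁.mul h₂.exp).congr_deriv ?_
  have e₁ : y ^ (p - 1) = y ^ (p - 3) * y ^ 2 := by
    rw [← Real.rpow_natCast, ← Real.rpow_add hy]
    congr 1
    push_cast
    ring
  rw [e₁, show p - 1 - 1 = p - 2 by ring]
  field_simp
  ring

lemma continuousOn_rpow_mul_exp_neg_div {p c b : ℝ} (hp : 1 < p) (hc : 0 ≤ c) (hb : 0 ≤ b) :
    ContinuousOn (fun y : ℝ => y ^ (p - 1) * Real.exp (-((c + b / y) / 2))) (Ici 0) := by
  intro y hy
  rcases (mem_Ici.1 hy).eq_or_lt with rfl | hy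
  · have h₀ : (0 : ℝ) ^ (p - 1) = 0 := Real.zero_rpow (by linarith)
    have hpow : Filter.Tendsto (fun y : ℝ => y ^ (p - 1)) (nhdsWithin 0 (Ici 0)) (nhds 0) := by
      have h := (Real.continuousAt_rpow_const (0 : ℝ) (p - 1)
        (Or.inr (by linarith))).continuousWithinAt (s := Ici 0)
      simpa only [ContinuousWithinAt, h₀] using h
    simp only [ContinuousWithinAt, h₀, zero_mul]
    refine tendsto_of_tendsto_of_tendsto_of_le_of_le' tendsto_const_nhds hpow ?_ ?_
    · filter_upwards [self_mem_nhdsWithin] with z hz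
      have hz : 0 ≤ z := hz
      positivity
    · filter_upwards [self_mem_nhdsWithin] with z hz
      have hz : 0 ≤ z := hz
      refine mul_le_of_le_one_right (by positivity) (Real.exp_le_one_iff.2 ?_)
      have : 0 ≤ (c + b / z) / 2 := by positivity
      linarith
  · exact (hasDerivAt_rpow_mul_exp_neg_div p c b hy).continuousAt.continuousWithinAt

/-- The unnormalized form of the representation of the GIG kernel as a continuous mixture
of truncated Exponential(a/2) densities (proof of Proposition 4). -/
theorem gig_kernel_truncated_exp_mixture (p a b : ℝ) (hp : 1 < p) (ha : 0 < a) (hb : 0 < b)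
    (x : ℝ) (hx : 0 < x) :
    x ^ (p - 1) * Real.exp (-((a * x + b / x) / 2)) =
      ∫ y in Ioo (0 : ℝ) x,
        Real.exp (-(a / 2) * (x - y)) *
          ((b / 2) * y ^ (p - 3) + (p - 1) * y ^ (p - 2)) *
          Real.exp (-((a * y + b / y) / 2)) := by
  have hcont := (continuousOn_rpow_mul_exp_neg_div hp (mul_pos ha hx).le hb.le).mono
    (Icc_subset_Ici_self : Icc 0 x ⊆ Ici 0)
  have hderiv : ∀ y ∈ Ioo 0 x, _ := fun y hy =>
    hasDerivAt_rpow_mul_exp_neg_div p (a * x) b hy.1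
  have hint := intervalIntegral.integrableOn_deriv_of_nonneg hcont hderiv fun y hy => by
    have := hy.1
    have : 0 < p - 1 := by linarith
    positivity
  have hftc := intervalIntegral.integral_eq_sub_of_hasDerivAt_of_le hx.le hcont hderiv
    ((intervalIntegrable_iff_integrableOn_Ioc_of_le hx.le).2 hint)
  rw [intervalIntegral.integral_of_le hx.le, integral_Ioc_eq_integral_Ioo,
    Real.zero_rpow (by linarith), zero_mul, sub_zero] at hftc
  rw [← hftc]
  congr 1 with y
  rw [mul_right_comm, ← Real.exp_add, mul_comm]
  congr 2
  ring
end

section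
/- Let a, b > 0, y ≥ 0, and α ∈ ℝ. Then ∫₀^∞ [ 1 + α · (1/x − 3/(2b))² ] · f_IG(x; √(b/(a+2y)), b) dx = 1 + 9α/(4b²) + α a/b + 2 α y/b. (This exact conditional-expectation identity, computed from the inverse moments of the inverse Gaussian, is the key step for the drift condition in the proof of geometric ergodicity of the Gibbs sampler, case p < −1/2, Proposition 3.) -/
open Real MeasureTheory Set

open Filter Topology

/-- The fundamental theorem of calculus on `(a, ∞)` with one-sided limits at both ends. -/
theorem integral_Ioi_of_hasDerivAt_of_tendsto_nhdsGT {f f' : ℝ → ℝ} {a l m : ℝ}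
    (hderiv : ∀ x ∈ Ioi a, HasDerivAt f (f' x) x) (hint : IntegrableOn f' (Ioi a))
    (ha : Tendsto f (𝓝[>] a) (𝓝 l)) (htop : Tendsto f atTop (𝓝 m)) :
    ∫ x in Ioi a, f' x = m - l := by
  have hcont : ContinuousWithinAt (Function.update f a l) (Ici a) a := by
    rw [continuousWithinAt_update_same]
    simpa using ha
  have hd : ∀ x ∈ Ioi a, HasDerivAt (Function.update f a l) (f' x) x := by
    intro x hx
    refine (hderiv x hx).congr_of_eventuallyEq ?_
    filter_upwards [Ioi_mem_nhds hx] with z hz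
    exact Function.update_of_ne (ne_of_gt hz) _ _
  have ht : Tendsto (Function.update f a l) atTop (𝓝 m) := by
    refine htop.congr' ?_
    filter_upwards [eventually_gt_atTop a] with z hz
    exact (Function.update_of_ne (ne_of_gt hz) _ _).symm
  simpa using integral_Ioi_of_hasDerivAt_of_tendsto hcont hd hint ht

/-- The unnormalized inverse Gaussian density with mean `1 / c` and shape `b`. -/
noncomputable def invGaussKernel (b c x : ℝ) : ℝ :=
  x ^ (-(3 / 2) : ℝ) * exp (-(b / 2) * (c ^ 2 * x - 2 * c + 1 / x))

theorem exp_neg_div_le {b x : ℝ} (hb : 0 < b) (hx : 0 < x) (n : ℕ) :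
    exp (-(b / x)) ≤ n.factorial / b ^ n * x ^ n := by
  have h := pow_div_factorial_le_exp (x := b / x) (by positivity) n
  rw [exp_neg, inv_le_comm₀ (exp_pos _) (by positivity)]
  refine le_trans (le_of_eq ?_) h
  rw [div_pow]
  field_simp

theorem invGaussKernel_nonneg {b c x : ℝ} (hx : 0 < x) : 0 ≤ invGaussKernel b c x := by
  unfold invGaussKernel
  positivity

theorem invGaussKernel_le_rpow {b c x : ℝ} (hb : 0 < b) (hx : 0 < x) :
    invGaussKernel b c x ≤ x ^ (-(3 / 2) : ℝ) := by
  unfold invGaussKernel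
  refine mul_le_of_le_one_right (by positivity) (exp_le_one_iff.2 ?_)
  have : c ^ 2 * x - 2 * c + 1 / x = (c * x - 1) ^ 2 / x := by field_simp; ring
  rw [this, neg_mul, neg_nonpos]
  positivity

theorem inv_pow_mul_invGaussKernel_le {b c x : ℝ} (hb : 0 < b) (hx : 0 < x) (j : ℕ) :
    (1 / x) ^ j * invGaussKernel b c x ≤
      (j + 1).factorial / (b / 2) ^ (j + 1) * exp (b * c) *
        (x ^ (-(1 / 2) : ℝ) * exp (-(b / 2 * c ^ 2) * x ^ (1 : ℝ))) := by
  unfold invGaussKernel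
  have h := exp_neg_div_le (half_pos hb) hx (j + 1)
  have he : exp (-(b / 2) * (c ^ 2 * x - 2 * c + 1 / x)) =
      exp (b * c) * exp (-(b / 2 * c ^ 2) * x ^ (1 : ℝ)) * exp (-(b / 2 / x)) := by
    rw [← exp_add, ← exp_add, rpow_one]
    congr 1
    ring
  have hr : x ^ (-(1 / 2) : ℝ) = x ^ (-(3 / 2) : ℝ) * x := by
    rw [← rpow_add_one hx.ne']
    norm_num
  rw [he, hr]
  calc _ = (1 / x) ^ j * x ^ (-(3 / 2) : ℝ) *
        (exp (b * c) * exp (-(b / 2 * c ^ 2) * x ^ (1 : ℝ))) * exp (-(b / 2 / x)) := by ring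
    _ ≤ (1 / x) ^ j * x ^ (-(3 / 2) : ℝ) *
        (exp (b * c) * exp (-(b / 2 * c ^ 2) * x ^ (1 : ℝ))) *
          ((j + 1).factorial / (b / 2) ^ (j + 1) * x ^ (j + 1)) := by gcongr
    _ = _ := by
      rw [one_div, inv_pow, pow_succ x j]
      field_simp

theorem integrableOn_inv_pow_mul_invGaussKernel {b c : ℝ} (hb : 0 < b) (hc : 0 < c) (j : ℕ) :
    IntegrableOn (fun x => (1 / x) ^ j * invGaussKernel b c x) (Ioi 0) := by
  have h := (integrableOn_rpow_mul_exp_neg_mul_rpow (p := 1) (s := -(1 / 2)) (b := b / 2 * c ^ 2)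
    (by norm_num) one_pos (by positivity)).const_mul
      ((j + 1).factorial / (b / 2) ^ (j + 1) * exp (b * c))
  refine Integrable.mono' h ?_ ?_
  · unfold invGaussKernel
    exact (by fun_prop : Measurable _).aestronglyMeasurable
  · filter_upwards [ae_restrict_mem measurableSet_Ioi] with x hx
    have hx : 0 < x := hx
    rw [norm_of_nonneg (mul_nonneg (by positivity) (invGaussKernel_nonneg hx))]
    exact inv_pow_mul_invGaussKernel_le hb hx j

theorem tendsto_invGaussKernel_nhdsGT_zero {b : ℝ} (c : ℝ) (hb : 0 < b) :
    Tendsto (invGaussKernel b c) (𝓝[>] 0) (𝓝 0) := by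
  have hlim : Tendsto (fun x : ℝ => 2 / (b / 2) ^ 2 * exp (b * c) * x ^ (1 / 2 : ℝ))
      (𝓝[>] 0) (𝓝 0) := by
    have h : ContinuousAt (fun x : ℝ => x ^ (1 / 2 : ℝ)) 0 :=
      continuousAt_rpow_const _ _ (Or.inr (by norm_num))
    have h' := (h.tendsto.const_mul (2 / (b / 2) ^ 2 * exp (b * c))).mono_left
      (nhdsWithin_le_nhds (s := Ioi 0))
    simpa using h'
  refine squeeze_zero' ?_ ?_ hlim
  · filter_upwards [self_mem_nhdsWithin] with x hx using invGaussKernel_nonneg hx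
  · filter_upwards [self_mem_nhdsWithin] with x hx
    have hx : 0 < x := hx
    have h := inv_pow_mul_invGaussKernel_le (c := c) hb hx 1
    have hr : x ^ (1 / 2 : ℝ) = x ^ (-(1 / 2) : ℝ) * x := by
      rw [← rpow_add_one hx.ne']
      norm_num
    have he : exp (-(b / 2 * c ^ 2) * x ^ (1 : ℝ)) ≤ 1 := by
      rw [exp_le_one_iff, rpow_one, neg_mul, neg_nonpos]
      positivity
    calc invGaussKernel b c x = x * ((1 / x) ^ 1 * invGaussKernel b c x) := by field_simp
      _ ≤ x * ((1 + 1).factorial / (b / 2) ^ (1 + 1) * exp (b * c) *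
        (x ^ (-(1 / 2) : ℝ) * exp (-(b / 2 * c ^ 2) * x ^ (1 : ℝ)))) := by gcongr
      _ ≤ x * ((1 + 1).factorial / (b / 2) ^ (1 + 1) * exp (b * c) *
        (x ^ (-(1 / 2) : ℝ) * 1)) := by gcongr
      _ = _ := by
        rw [hr]
        norm_num [Nat.factorial]
        ring

theorem tendsto_invGaussKernel_atTop {b : ℝ} (c : ℝ) (hb : 0 < b) :
    Tendsto (invGaussKernel b c) atTop (𝓝 0) := by
  refine squeeze_zero' ?_ ?_ (tendsto_rpow_neg_atTop (y := 3 / 2) (by norm_num))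
  · filter_upwards [eventually_gt_atTop 0] with x hx using invGaussKernel_nonneg hx
  · filter_upwards [eventually_gt_atTop 0] with x hx using invGaussKernel_le_rpow hb hx

theorem hasDerivAt_invGaussKernel (b c : ℝ) {x : ℝ} (hx : 0 < x) :
    HasDerivAt (invGaussKernel b c)
      ((b / 2 * (1 / x) ^ 2 - 3 / 2 * (1 / x) - b / 2 * c ^ 2) * invGaussKernel b c x) x := by
  have h1 : HasDerivAt (fun x : ℝ => x ^ (-(3 / 2) : ℝ))
      (-(3 / 2) * x ^ (-(3 / 2) - 1 : ℝ)) x := hasDerivAt_rpow_const (Or.inl hx.ne')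
  have h2 : HasDerivAt (fun x : ℝ => -(b / 2) * (c ^ 2 * x - 2 * c + 1 / x))
      (-(b / 2) * (c ^ 2 * 1 + -(x ^ 2)⁻¹)) x := by
    simp only [one_div]
    exact ((((hasDerivAt_id x).const_mul (c ^ 2)).sub_const (2 * c)).add
      (hasDerivAt_inv hx.ne')).const_mul _
  refine (h1.mul h2.exp).congr_deriv ?_
  rw [rpow_sub_one hx.ne']
  unfold invGaussKernel
  field_simp
  ring

theorem integrableOn_deriv_invGaussKernel {b c : ℝ} (hb : 0 < b) (hc : 0 < c) :
    IntegrableOn (fun x => (b / 2 * (1 / x) ^ 2 - 3 / 2 * (1 / x) - b / 2 * c ^ 2) *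
      invGaussKernel b c x) (Ioi 0) := by
  have hi := integrableOn_inv_pow_mul_invGaussKernel hb hc
  refine ((((hi 2).const_mul (b / 2)).sub ((hi 1).const_mul (3 / 2))).sub
    ((hi 0).const_mul (b / 2 * c ^ 2))).congr (ae_of_all _ fun x => ?_)
  simp only [Pi.sub_apply]
  ring

theorem integral_stein_invGaussKernel {b c : ℝ} (hb : 0 < b) (hc : 0 < c) :
    ∫ x in Ioi (0 : ℝ),
      (b / 2 * (1 / x) ^ 2 - 3 / 2 * (1 / x) - b / 2 * c ^ 2) * invGaussKernel b c x = 0 := by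
  simpa using integral_Ioi_of_hasDerivAt_of_tendsto_nhdsGT
    (fun x hx => hasDerivAt_invGaussKernel b c hx) (integrableOn_deriv_invGaussKernel hb hc)
    (tendsto_invGaussKernel_nhdsGT_zero c hb) (tendsto_invGaussKernel_atTop c hb)

/-- The primitive of the unnormalized standard Gaussian density vanishing at `0`. -/
noncomputable def gaussPrimitive (t : ℝ) : ℝ := ∫ s in (0 : ℝ)..t, exp (-(1 / 2) * s ^ 2)

theorem hasDerivAt_gaussPrimitive (t : ℝ) :
    HasDerivAt gaussPrimitive (exp (-(1 / 2) * t ^ 2)) t :=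
  ((by fun_prop : Continuous fun s : ℝ => exp (-(1 / 2) * s ^ 2)).integral_hasStrictDerivAt
    0 t).hasDerivAt

theorem tendsto_gaussPrimitive_atTop :
    Tendsto gaussPrimitive atTop (𝓝 (√(2 * π) / 2)) := by
  have h := intervalIntegral_tendsto_integral_Ioi 0
    (integrable_exp_neg_mul_sq (b := 1 / 2) (by norm_num)).integrableOn tendsto_id
  rw [integral_gaussian_Ioi, show π / (1 / 2) = 2 * π by ring] at h
  exact h

theorem gaussPrimitive_neg (t : ℝ) : gaussPrimitive (-t) = -gaussPrimitive t := by
  unfold gaussPrimitive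
  have h := intervalIntegral.integral_comp_neg (a := 0) (b := t)
    (fun s : ℝ => exp (-(1 / 2) * s ^ 2))
  simp only [neg_sq, neg_zero] at h
  rw [h, intervalIntegral.integral_symm]

theorem tendsto_gaussPrimitive_atBot :
    Tendsto gaussPrimitive atBot (𝓝 (-(√(2 * π) / 2))) := by
  refine (tendsto_gaussPrimitive_atTop.comp tendsto_neg_atBot_atTop).neg.congr fun t => ?_
  simp [gaussPrimitive_neg]

theorem integral_invGaussKernel {b c : ℝ} (hb : 0 < b) (hc : 0 < c) :
    ∫ x in Ioi (0 : ℝ), invGaussKernel b c x = √(2 * π) / √b := by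
  have hsb : 0 < √b := sqrt_pos.2 hb
  let A : ℝ → ℝ := fun x => √b * (c * √x - (√x)⁻¹)
  let B : ℝ → ℝ := fun x => √b * (c * √x + (√x)⁻¹)
  let F : ℝ → ℝ := fun x => gaussPrimitive (A x) - exp (2 * b * c) * gaussPrimitive (B x)
  have hderiv : ∀ x ∈ Ioi (0 : ℝ), HasDerivAt F (√b * invGaussKernel b c x) x := by
    intro x hx
    have hx : 0 < x := hx
    have hs : 0 < √x := sqrt_pos.2 hx
    have hd := hasDerivAt_sqrt hx.ne'
    have hA : HasDerivAt A _ x := ((hd.const_mul c).sub (hd.inv hs.ne')).const_mul (√b)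
    have hB : HasDerivAt B _ x := ((hd.const_mul c).add (hd.inv hs.ne')).const_mul (√b)
    refine (((hasDerivAt_gaussPrimitive (A x)).comp x hA).sub
      (((hasDerivAt_gaussPrimitive (B x)).comp x hB).const_mul (exp (2 * b * c)))).congr_deriv ?_
    have hsx : √x ^ 2 = x := sq_sqrt hx.le
    have eA : -(1 / 2) * A x ^ 2 = -(b / 2) * (c ^ 2 * x - 2 * c + 1 / x) := by
      simp only [A]
      rw [mul_pow, sq_sqrt hb.le, ← hsx]
      rw [sqrt_sq hs.le]
      field_simp
      ring
    have eB : exp (2 * b * c) * exp (-(1 / 2) * B x ^ 2) =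
        exp (-(b / 2) * (c ^ 2 * x - 2 * c + 1 / x)) := by
      rw [← exp_add]
      congr 1
      simp only [B]
      rw [mul_pow, sq_sqrt hb.le, ← hsx]
      rw [sqrt_sq hs.le]
      field_simp
      ring
    have er : x ^ (-(3 / 2) : ℝ) = (√x ^ 3)⁻¹ := by
      rw [rpow_neg hx.le, sqrt_eq_rpow, ← rpow_natCast, ← rpow_mul hx.le]
      norm_num
    rw [← mul_assoc (exp (2 * b * c)), eB, eA, invGaussKernel, er]
    field_simp
    ring
  have hs0 : Tendsto (fun x : ℝ => √x) (𝓝[>] 0) (𝓝[>] 0) := by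
    refine tendsto_nhdsWithin_iff.2 ⟨?_, ?_⟩
    · simpa using (continuous_sqrt.tendsto 0).mono_left (nhdsWithin_le_nhds (s := Ioi (0 : ℝ)))
    · filter_upwards [self_mem_nhdsWithin] with x hx using sqrt_pos.2 hx
  have hc0 : Tendsto (fun x : ℝ => c * √x) (𝓝[>] 0) (𝓝 0) := by
    simpa using (hs0.mono_right nhdsWithin_le_nhds).const_mul c
  have hi0 : Tendsto (fun x : ℝ => (√x)⁻¹) (𝓝[>] 0) atTop := tendsto_inv_nhdsGT_zero.comp hs0
  have hA0 : Tendsto A (𝓝[>] 0) atBot :=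
    (hc0.add_atBot (tendsto_neg_atTop_atBot.comp hi0)).const_mul_atBot hsb
  have hB0 : Tendsto B (𝓝[>] 0) atTop := (hc0.add_atTop hi0).const_mul_atTop hsb
  have hct : Tendsto (fun x : ℝ => c * √x) atTop atTop := tendsto_sqrt_atTop.const_mul_atTop hc
  have hit : Tendsto (fun x : ℝ => (√x)⁻¹) atTop (𝓝 0) :=
    tendsto_inv_atTop_zero.comp tendsto_sqrt_atTop
  have hAt : Tendsto A atTop atTop := (hct.atTop_add hit.neg).const_mul_atTop hsb
  have hBt : Tendsto B atTop atTop := (hct.atTop_add hit).const_mul_atTop hsb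
  have hF0 := (tendsto_gaussPrimitive_atBot.comp hA0).sub
    ((tendsto_gaussPrimitive_atTop.comp hB0).const_mul (exp (2 * b * c)))
  have hFt := (tendsto_gaussPrimitive_atTop.comp hAt).sub
    ((tendsto_gaussPrimitive_atTop.comp hBt).const_mul (exp (2 * b * c)))
  have hint : IntegrableOn (fun x => √b * invGaussKernel b c x) (Ioi 0) := by
    simpa [IntegrableOn] using (integrableOn_inv_pow_mul_invGaussKernel hb hc 0).const_mul (√b)
  have h := integral_Ioi_of_hasDerivAt_of_tendsto_nhdsGT hderiv hint hF0 hFt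
  rw [integral_const_mul] at h
  rw [eq_div_iff hsb.ne', mul_comm, h]
  ring

theorem invGaussPdf_eq_invGaussKernel {b c x : ℝ} (hb : 0 < b) (hc : 0 < c) (hx : 0 < x) :
    invGaussPdf c⁻¹ b x = √b / √(2 * π) * invGaussKernel b c x := by
  unfold invGaussPdf invGaussKernel
  have er : x ^ (-(3 / 2) : ℝ) = (√(x ^ 3))⁻¹ := by
    rw [rpow_neg hx.le, sqrt_eq_rpow, ← rpow_natCast, ← rpow_mul hx.le]
    norm_num
  rw [sqrt_div hb.le, sqrt_mul (by positivity), er]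
  have he : -(b * (x - c⁻¹) ^ 2) / (2 * c⁻¹ ^ 2 * x) =
      -(b / 2) * (c ^ 2 * x - 2 * c + 1 / x) := by
    field_simp
    ring
  rw [he]
  field_simp

/-- The exact conditional-expectation identity for the drift condition in the proof of
geometric ergodicity, case p < -1/2 (Proposition 3). -/
theorem invGauss_drift_identity_neg (a b y α : ℝ) (ha : 0 < a) (hb : 0 < b) (hy : 0 ≤ y) :
    ∫ x in Ioi (0 : ℝ),
        (1 + α * (1 / x - 3 / (2 * b)) ^ 2) * invGaussPdf (Real.sqrt (b / (a + 2 * y))) b x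
      = 1 + 9 * α / (4 * b ^ 2) + α * a / b + 2 * α * y / b := by
  have hay : 0 < a + 2 * y := by positivity
  obtain ⟨c, hc⟩ : ∃ c, c = √((a + 2 * y) / b) := ⟨_, rfl⟩
  have hc0 : 0 < c := hc ▸ sqrt_pos.2 (by positivity)
  have hc2 : c ^ 2 = (a + 2 * y) / b := by rw [hc, sq_sqrt (by positivity)]
  have hμ : √(b / (a + 2 * y)) = c⁻¹ := by rw [hc, ← sqrt_inv, inv_div]
  have hK := integral_invGaussKernel hb hc0
  have hS := integral_stein_invGaussKernel hb hc0
  have hiK : IntegrableOn (invGaussKernel b c) (Ioi 0) := by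
    simpa using integrableOn_inv_pow_mul_invGaussKernel hb hc0 0
  have hiS := integrableOn_deriv_invGaussKernel hb hc0
  have hsplit : ∀ x ∈ Ioi (0 : ℝ),
      (1 + α * (1 / x - 3 / (2 * b)) ^ 2) * invGaussPdf (√(b / (a + 2 * y))) b x =
      √b / √(2 * π) * ((1 + α * (c ^ 2 + 9 / (4 * b ^ 2))) * invGaussKernel b c x +
        2 * α / b * ((b / 2 * (1 / x) ^ 2 - 3 / 2 * (1 / x) - b / 2 * c ^ 2) *
          invGaussKernel b c x)) := by
    intro x hx
    have hx : 0 < x := hx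
    rw [hμ, invGaussPdf_eq_invGaussKernel hb hc0 hx]
    field_simp
    ring
  rw [setIntegral_congr_fun measurableSet_Ioi hsplit, integral_const_mul,
    integral_add (hiK.const_mul _) (hiS.const_mul _), integral_const_mul, integral_const_mul,
    hK, hS, hc2]
  have : 0 < √b := sqrt_pos.2 hb
  have : 0 < √(2 * π) := sqrt_pos.2 (by positivity)
  field_simp
  ring
end

section
/- Let a, b > 0, y ≥ 0, and α ∈ ℝ. Then ∫₀^∞ [ 1 + α · (x − 1/(2a))² ] · f_IG(x; √((b+2y)/a), b+2y) dx = 1 + α/(4a²) + α b/a + 2 α y/a. (This exact conditional-expectation identity, computed from the mean and variance of the inverse Gaussian, is the key step for the drift condition in the proof of geometric ergodicity of the Gibbs sampler, case p > −1/2, Proposition 3.) -/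
open Real MeasureTheory Set

theorem integrable_sq_mul_exp_neg_mul_sq {c : ℝ} (hc : 0 < c) :
    Integrable fun x : ℝ => x ^ 2 * exp (-c * x ^ 2) := by
  simpa using integrable_rpow_mul_exp_neg_mul_sq hc (s := 2) (by norm_num)

theorem integral_sq_mul_exp_neg_mul_sq {c : ℝ} (hc : 0 < c) :
    ∫ x : ℝ, x ^ 2 * exp (-c * x ^ 2) = √(π / c) / (2 * c) := by
  have hd (x : ℝ) : HasDerivAt (fun x : ℝ => x * exp (-c * x ^ 2))
      (exp (-c * x ^ 2) - 2 * c * (x ^ 2 * exp (-c * x ^ 2))) x := by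
    refine ((hasDerivAt_id' x).mul
      (((hasDerivAt_pow 2 x).const_mul (-c)).exp)).congr_deriv ?_
    push_cast
    ring
  have h0 := integrable_exp_neg_mul_sq hc
  have h2 := (integrable_sq_mul_exp_neg_mul_sq hc).const_mul (2 * c)
  have h := integral_eq_zero_of_hasDerivAt_of_integrable hd (h0.sub h2)
    (integrable_mul_exp_neg_mul_sq hc)
  rw [integral_sub h0 h2, integral_const_mul, integral_gaussian] at h
  rw [eq_div_iff (by positivity)]
  linarith

theorem integrable_cosh_mul_comp_sinh {g : ℝ → ℝ} (hg : Integrable g) :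
    Integrable fun s => cosh s * g (sinh s) := by
  have h := (integrableOn_image_iff_integrableOn_abs_deriv_smul MeasurableSet.univ
    (fun x _ => (Real.hasDerivAt_sinh x).hasDerivWithinAt) sinh_injective.injOn g).1
    hg.integrableOn
  simpa [abs_of_pos (cosh_pos _)] using h

theorem integral_cosh_mul_comp_sinh (g : ℝ → ℝ) :
    ∫ s, cosh s * g (sinh s) = ∫ u, g u := by
  have h := integral_image_eq_integral_abs_deriv_smul MeasurableSet.univ
    (fun x _ => (Real.hasDerivAt_sinh x).hasDerivWithinAt) sinh_injective.injOn g
  rw [image_univ, sinh_surjective.range_eq] at h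
  simpa [abs_of_pos (cosh_pos _)] using h.symm

/-- Against an even weight, `exp (k * s)` may be replaced by its even part. -/
theorem integrable_exp_mul_of_cosh_mul {w : ℝ → ℝ} (hw : Continuous w) (hw0 : ∀ s, 0 ≤ w s)
    {k : ℝ} (h : Integrable fun s => cosh (k * s) * w s) :
    Integrable fun s => exp (k * s) * w s := by
  refine (h.const_mul 2).mono' (by fun_prop) (.of_forall fun s => ?_)
  rw [norm_of_nonneg (mul_nonneg (exp_pos _).le (hw0 s)), cosh_eq]
  nlinarith [mul_nonneg (exp_pos (-(k * s))).le (hw0 s)]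

theorem integral_exp_mul_eq_cosh_mul {w : ℝ → ℝ} (hw : Continuous w) (hw0 : ∀ s, 0 ≤ w s)
    (hw_even : ∀ s, w (-s) = w s) {k : ℝ} (h : Integrable fun s => cosh (k * s) * w s) :
    ∫ s, exp (k * s) * w s = ∫ s, cosh (k * s) * w s := by
  have h1 := integrable_exp_mul_of_cosh_mul hw hw0 h
  have h2 := h1.comp_neg
  have h3 := integral_neg_eq_self (fun s => exp (k * s) * w s) volume
  have h4 : (fun s => cosh (k * s) * w s) =
      fun s => (exp (k * s) * w s + exp (k * -s) * w (-s)) / 2 := by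
    ext s
    rw [cosh_eq, hw_even]
    ring_nf
  rw [h4, integral_div, integral_add h1 h2, h3]
  ring

theorem integrable_exp_mul_exp_neg_mul_sinh_sq {c : ℝ} (hc : 0 < c) {k : ℝ}
    (hk : k = -1 ∨ k = 1) :
    Integrable (fun s => exp (k * s) * exp (-c * sinh s ^ 2)) ∧
      ∫ s, exp (k * s) * exp (-c * sinh s ^ 2) = √(π / c) := by
  have hcosh (s : ℝ) : cosh (k * s) = cosh s := by rcases hk with rfl | rfl <;> simp
  have h : Integrable fun s => cosh (k * s) * exp (-c * sinh s ^ 2) := by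
    simpa only [hcosh] using integrable_cosh_mul_comp_sinh (integrable_exp_neg_mul_sq hc)
  refine ⟨integrable_exp_mul_of_cosh_mul (by fun_prop) (fun s => (exp_pos _).le) h, ?_⟩
  rw [integral_exp_mul_eq_cosh_mul (by fun_prop) (fun s => (exp_pos _).le) (by simp) h]
  simp only [hcosh]
  rw [integral_cosh_mul_comp_sinh (fun u => exp (-c * u ^ 2)), integral_gaussian]

theorem integrable_exp_three_mul_exp_neg_mul_sinh_sq {c : ℝ} (hc : 0 < c) :
    Integrable (fun s => exp (3 * s) * exp (-c * sinh s ^ 2)) ∧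
      ∫ s, exp (3 * s) * exp (-c * sinh s ^ 2) = √(π / c) * (1 + 2 / c) := by
  have hcosh : (fun s => cosh (3 * s) * exp (-c * sinh s ^ 2)) = fun s =>
      cosh s * (exp (-c * sinh s ^ 2) + 4 * (sinh s ^ 2 * exp (-c * sinh s ^ 2))) := by
    ext s
    rw [cosh_three_mul, pow_succ (cosh s) 2, cosh_sq]
    ring
  have h0 := integrable_exp_neg_mul_sq hc
  have h2 := (integrable_sq_mul_exp_neg_mul_sq hc).const_mul 4
  have h : Integrable fun s => cosh (3 * s) * exp (-c * sinh s ^ 2) := by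
    rw [hcosh]
    exact integrable_cosh_mul_comp_sinh (h0.add h2)
  refine ⟨integrable_exp_mul_of_cosh_mul (by fun_prop) (fun s => (exp_pos _).le) h, ?_⟩
  rw [integral_exp_mul_eq_cosh_mul (by fun_prop) (fun s => (exp_pos _).le) (by simp) h, hcosh,
    integral_cosh_mul_comp_sinh (fun u => exp (-c * u ^ 2) + 4 * (u ^ 2 * exp (-c * u ^ 2))),
    integral_add h0 h2, integral_const_mul, integral_gaussian, integral_sq_mul_exp_neg_mul_sq hc]
  field_simp
  ring

theorem invGaussPdf_mul_exp {μ l : ℝ} (hμ : 0 < μ) (hl : 0 < l) (s : ℝ) :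
    2 * μ * exp (2 * s) * invGaussPdf μ l (μ * exp (2 * s)) =
      √(2 * l / μ / π) * (exp (-1 * s) * exp (-(2 * l / μ) * sinh s ^ 2)) := by
  have hsq : √(l / (2 * π * (μ * exp (2 * s)) ^ 3)) =
      √(2 * l / μ / π) * exp (-1 * s) / (2 * μ * exp (2 * s)) := by
    rw [sqrt_eq_iff_mul_self_eq_of_pos (by positivity)]
    have h1 : exp (-1 * s) = (exp s)⁻¹ := by rw [← exp_neg]; ring_nf
    have h2 : exp (2 * s) = exp s ^ 2 := by rw [← exp_nat_mul]; norm_num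
    have h3 : √(2 * l / μ / π) ^ 2 = 2 * l / μ / π := sq_sqrt (by positivity)
    rw [h1, h2, ← sq, div_pow, mul_pow, h3]
    field_simp
  have hexp : -(l * (μ * exp (2 * s) - μ) ^ 2) / (2 * μ ^ 2 * (μ * exp (2 * s))) =
      -(2 * l / μ) * sinh s ^ 2 := by
    have h2 : exp (2 * s) = exp s ^ 2 := by rw [← exp_nat_mul]; norm_num
    rw [sinh_eq, exp_neg, h2]
    field_simp
  rw [invGaussPdf, hsq, hexp]
  field_simp

theorem image_mul_exp_two_mul {μ : ℝ} (hμ : 0 < μ) :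
    (fun s : ℝ => μ * exp (2 * s)) '' univ = Ioi 0 := by
  ext x
  simp only [image_univ, mem_range, mem_Ioi]
  constructor
  · rintro ⟨s, rfl⟩
    positivity
  · intro hx
    refine ⟨log (x / μ) / 2, ?_⟩
    rw [mul_div_cancel₀ _ two_ne_zero, exp_log (by positivity)]
    field_simp

/-- The substitution `x = μ * exp (2 * s)` turns inverse Gaussian moments into integrals over
the real line. -/
theorem pow_mul_invGaussPdf_substitution {μ l : ℝ} (hμ : 0 < μ) (hl : 0 < l) (n : ℕ) :
    (Integrable (fun s => exp ((2 * n - 1) * s) * exp (-(2 * l / μ) * sinh s ^ 2)) →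
      IntegrableOn (fun x => x ^ n * invGaussPdf μ l x) (Ioi 0)) ∧
    ∫ x in Ioi 0, x ^ n * invGaussPdf μ l x = √(2 * l / μ / π) * μ ^ n *
      ∫ s, exp ((2 * n - 1) * s) * exp (-(2 * l / μ) * sinh s ^ 2) := by
  have hd : ∀ s ∈ univ, HasDerivWithinAt (fun s : ℝ => μ * exp (2 * s))
      (2 * μ * exp (2 * s)) univ s := by
    intro s _
    refine ((((hasDerivAt_id' s).const_mul 2).exp.const_mul μ).congr_deriv ?_).hasDerivWithinAt
    ring
  have hinj : InjOn (fun s : ℝ => μ * exp (2 * s)) univ := by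
    intro s _ t _ h
    simpa [hμ.ne'] using h
  have hfun : (fun s => |2 * μ * exp (2 * s)| •
      ((μ * exp (2 * s)) ^ n * invGaussPdf μ l (μ * exp (2 * s)))) = fun s =>
      √(2 * l / μ / π) * μ ^ n *
        (exp ((2 * n - 1) * s) * exp (-(2 * l / μ) * sinh s ^ 2)) := by
    ext s
    have h1 : exp ((2 * n - 1) * s) = exp (2 * s) ^ n * exp (-1 * s) := by
      rw [← exp_nat_mul, ← exp_add]
      ring_nf
    rw [abs_of_pos (by positivity), smul_eq_mul, mul_left_comm, invGaussPdf_mul_exp hμ hl, h1]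
    ring
  constructor
  · intro h
    rw [← image_mul_exp_two_mul hμ,
      integrableOn_image_iff_integrableOn_abs_deriv_smul MeasurableSet.univ hd hinj, hfun]
    exact (h.const_mul _).integrableOn
  · rw [← image_mul_exp_two_mul hμ,
      integral_image_eq_integral_abs_deriv_smul MeasurableSet.univ hd hinj, hfun,
      setIntegral_univ, integral_const_mul]

theorem integral_quadratic_mul_invGaussPdf {μ l : ℝ} (hμ : 0 < μ) (hl : 0 < l) (p q r : ℝ) :
    ∫ x in Ioi 0, (p + q * x + r * x ^ 2) * invGaussPdf μ l x =
      p + q * μ + r * (μ ^ 2 + μ ^ 3 / l) := by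
  have hc : 0 < 2 * l / μ := by positivity
  have hD : √(2 * l / μ / π) * √(π / (2 * l / μ)) = 1 := by
    rw [← sqrt_mul (by positivity), div_mul_div_cancel₀ pi_ne_zero, div_self hc.ne', sqrt_one]
  obtain ⟨i0, e0⟩ := pow_mul_invGaussPdf_substitution hμ hl 0
  obtain ⟨i1, e1⟩ := pow_mul_invGaussPdf_substitution hμ hl 1
  obtain ⟨i2, e2⟩ := pow_mul_invGaussPdf_substitution hμ hl 2
  have k0 : 2 * ((0 : ℕ) : ℝ) - 1 = -1 := by norm_num
  have k1 : 2 * ((1 : ℕ) : ℝ) - 1 = 1 := by norm_num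
  have k2 : 2 * ((2 : ℕ) : ℝ) - 1 = 3 := by norm_num
  rw [k0] at i0 e0
  rw [k1] at i1 e1
  rw [k2] at i2 e2
  obtain ⟨j0, f0⟩ := integrable_exp_mul_exp_neg_mul_sinh_sq hc (.inl rfl)
  obtain ⟨j1, f1⟩ := integrable_exp_mul_exp_neg_mul_sinh_sq hc (.inr rfl)
  obtain ⟨j2, f2⟩ := integrable_exp_three_mul_exp_neg_mul_sinh_sq hc
  have g0 := (i0 j0).const_mul p
  have g1 := (i1 j1).const_mul q
  have g2 := (i2 j2).const_mul r
  have hfun : (fun x => (p + q * x + r * x ^ 2) * invGaussPdf μ l x) = fun x =>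
      p * (x ^ 0 * invGaussPdf μ l x) + q * (x ^ 1 * invGaussPdf μ l x) +
        r * (x ^ 2 * invGaussPdf μ l x) := by
    ext x
    ring
  rw [hfun, integral_add (by exact g0.add g1) g2, integral_add g0 g1, integral_const_mul,
    integral_const_mul, integral_const_mul, e0, e1, e2, f0, f1, f2]
  have hr : 2 / (2 * l / μ) = μ / l := by field_simp
  rw [hr]
  linear_combination (p + q * μ + r * μ ^ 2 * (1 + μ / l)) * hD

/-- The exact conditional-expectation identity for the drift condition in the proof of
geometric ergodicity, case p > -1/2 (Proposition 3). -/
theorem invGauss_drift_identity_pos (a b y α : ℝ) (ha : 0 < a) (hb : 0 < b) (hy : 0 ≤ y) :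
    ∫ x in Ioi (0 : ℝ),
        (1 + α * (x - 1 / (2 * a)) ^ 2) *
          invGaussPdf (Real.sqrt ((b + 2 * y) / a)) (b + 2 * y) x
      = 1 + α / (4 * a ^ 2) + α * b / a + 2 * α * y / a := by
  have hl : 0 < b + 2 * y := by positivity
  have hμ : 0 < √((b + 2 * y) / a) := by positivity
  have hsq : √((b + 2 * y) / a) ^ 2 = (b + 2 * y) / a := sq_sqrt (by positivity)
  have hfun (x : ℝ) : 1 + α * (x - 1 / (2 * a)) ^ 2 =
      (1 + α / (4 * a ^ 2)) + (-α / a) * x + α * x ^ 2 := by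
    field_simp
    ring
  simp only [hfun]
  rw [integral_quadratic_mul_invGaussPdf hμ hl, pow_succ _ 2, hsq]
  field_simp
  ring
end

section
/- Let p < −1/2 and a, b > 0. Set θ = 3/(2b), μ = 3(1/2 − p)/(2b), and choose α, β with 0 < α < b²/(p² − 1/4) and α²/b² ≤ β < α/(p² − 1/4) (this interval of admissible β is nonempty). Define f(x) = 1 + α(1/x − θ)² for x > 0 and g(y) = 1 + β(y − μ)² for y > 0, and set k = 1 + 9α/(4b²) + α a/b + 2 α μ/b, m = β(p² − 1/4)/α, and n = 1 + 9β(1/2 − p)/(4b²). Then: (i) for every y > 0, ∫₀^∞ f(x) · f_IG(x; √(b/(a+2y)), b) dx ≤ g(y) + k; (ii) for every x > 0, ∫₀^∞ g(y) · γ(y; −(p+1/2), x) dy ≤ m · f(x) + n; and (iii) 0 < m < 1. (These are the geometric drift conditions verifying Theorem 3.5 of Johnson and Jones, which establish geometric ergodicity of the data-augmented Gibbs sampler for the GIG, case p < −1/2, Proposition 3.) -/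
open Real MeasureTheory Set

open Filter Topology

/-- The fundamental theorem of calculus on `(0, ∞)` for a nonnegative derivative, with limits at
both ends. -/
lemma integral_Ioi_zero_of_hasDerivAt_of_nonneg {G g : ℝ → ℝ} {l m : ℝ}
    (hderiv : ∀ x > 0, HasDerivAt G (g x) x) (hg : ∀ x > 0, 0 ≤ g x)
    (h0 : Tendsto G (𝓝[>] 0) (𝓝 l)) (hinf : Tendsto G atTop (𝓝 m)) :
    ∫ x in Ioi (0 : ℝ), g x = m - l := by
  have hne : ∀ x > (0 : ℝ), Function.update G 0 l =ᶠ[𝓝 x] G := fun x hx => by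
    filter_upwards [lt_mem_nhds hx] with y hy
    exact Function.update_of_ne hy.ne' _ _
  have h := integral_Ioi_of_hasDerivAt_of_nonneg (g := Function.update G 0 l) (g' := g)
    (a := 0) (l := m) ?_ (fun x hx => (hderiv x hx).congr_of_eventuallyEq (hne x hx)) hg ?_
  · simpa using h
  · rw [continuousWithinAt_update_same]
    simpa using h0
  · refine hinf.congr' ?_
    filter_upwards [eventually_gt_atTop 0] with x hx
    exact (Function.update_of_ne hx.ne' _ _).symm

/-- A centred normal distribution with precision `2 * c` has a differentiable distribution
function. -/
lemma exists_gaussian_primitive {c : ℝ} (hc : 0 < c) :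
    ∃ Φ : ℝ → ℝ, (∀ z, HasDerivAt Φ (√(c / π) * exp (-c * z ^ 2)) z) ∧
      Tendsto Φ atBot (𝓝 0) ∧ Tendsto Φ atTop (𝓝 1) := by
  have hcont : Continuous fun z : ℝ => √(c / π) * exp (-c * z ^ 2) := by fun_prop
  have hint : Integrable fun z : ℝ => √(c / π) * exp (-c * z ^ 2) :=
    (integrable_exp_neg_mul_sq hc).const_mul _
  have hsqrt : √(c / π) * √(π / c) = 1 := by
    rw [← sqrt_mul (by positivity)]
    field_simp
    simp
  have hpos : ∫ z in Ioi (0 : ℝ), √(c / π) * exp (-c * z ^ 2) = 1 / 2 := by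
    rw [integral_const_mul, integral_gaussian_Ioi]
    linarith
  have hneg : ∫ z in Iic (0 : ℝ), √(c / π) * exp (-c * z ^ 2) = 1 / 2 := by
    rw [← hpos, ← neg_zero, ← integral_comp_neg_Ioi]
    simp
  refine ⟨fun z => 1 / 2 + ∫ t in (0 : ℝ)..z, √(c / π) * exp (-c * t ^ 2), fun z => ?_, ?_, ?_⟩
  · exact (hcont.integral_hasStrictDerivAt 0 z).hasDerivAt.const_add _
  · have h := (intervalIntegral_tendsto_integral_Iic 0 hint.integrableOn
      tendsto_id).const_sub (1 / 2)
    rw [hneg, sub_self] at h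
    refine h.congr fun z => ?_
    rw [intervalIntegral.integral_symm z 0]
    exact sub_eq_add_neg _ _
  · have h := (intervalIntegral_tendsto_integral_Ioi 0 hint.integrableOn
      tendsto_id).const_add (1 / 2)
    rw [hpos] at h
    norm_num at h ⊢
    exact h

lemma invGaussPdf_eq {μ lam x : ℝ} (hμ : 0 < μ) (hlam : 0 < lam) (hx : 0 < x) :
    invGaussPdf μ lam x =
      √(lam / 2 / π) * (√x)⁻¹ ^ 3 * exp (-(lam / 2) * (√x / μ - (√x)⁻¹) ^ 2) := by
  obtain ⟨r, hr, rfl⟩ : ∃ r, 0 < r ∧ x = r ^ 2 := ⟨√x, by positivity, (sq_sqrt hx.le).symm⟩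
  rw [invGaussPdf, sqrt_sq hr.le]
  congr 1
  · rw [show lam / (2 * π * (r ^ 2) ^ 3) = lam / 2 / π * (r⁻¹ ^ 3) ^ 2 by field_simp,
      sqrt_mul (by positivity), sqrt_sq (by positivity)]
  · congr 1
    field_simp

lemma invGaussPdf_nonneg (μ lam x : ℝ) : 0 ≤ invGaussPdf μ lam x := by
  unfold invGaussPdf
  positivity

lemma hasDerivAt_inv_sqrt {x : ℝ} (hx : 0 < x) :
    HasDerivAt (fun x => (√x)⁻¹) (-(√x)⁻¹ / (2 * x)) x := by
  convert! (hasDerivAt_sqrt hx.ne').inv (sqrt_pos.2 hx).ne' using 1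
  have := sq_sqrt hx.le
  have : 0 < √x := sqrt_pos.2 hx
  field_simp
  linarith

lemma hasDerivAt_invGaussPdf {μ lam x : ℝ} (hμ : 0 < μ) (hlam : 0 < lam) (hx : 0 < x) :
    HasDerivAt (invGaussPdf μ lam)
      (invGaussPdf μ lam x *
        (-3 / (2 * x) - lam / (2 * μ ^ 2) + lam / (2 * x ^ 2))) x := by
  have hev : invGaussPdf μ lam =ᶠ[𝓝 x] fun x =>
      √(lam / 2 / π) * (√x)⁻¹ ^ 3 * exp (-(lam / 2) * (√x / μ - (√x)⁻¹) ^ 2) := by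
    filter_upwards [lt_mem_nhds hx] with y hy using invGaussPdf_eq hμ hlam hy
  refine HasDerivAt.congr_of_eventuallyEq ?_ hev
  have hv := hasDerivAt_inv_sqrt hx
  have hz := ((hasDerivAt_sqrt hx.ne').div_const μ).sub hv
  convert! ((hv.pow 3).const_mul √(lam / 2 / π)).mul
    (((hz.pow 2).const_mul (-(lam / 2))).exp) using 1
  rw [invGaussPdf_eq hμ hlam hx]
  simp only [Pi.sub_apply, Pi.pow_apply, Nat.reduceSub, pow_one]
  obtain ⟨r, hr, rfl⟩ : ∃ r, 0 < r ∧ x = r ^ 2 := ⟨√x, by positivity, (sq_sqrt hx.le).symm⟩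
  rw [sqrt_sq hr.le]
  field_simp
  ring

lemma tendsto_inv_sqrt_nhdsGT_zero : Tendsto (fun x : ℝ => (√x)⁻¹) (𝓝[>] 0) atTop := by
  refine tendsto_inv_nhdsGT_zero.comp (tendsto_nhdsWithin_iff.2 ⟨?_, ?_⟩)
  · have h : Tendsto Real.sqrt (𝓝 0) (𝓝 0) := by
      simpa using continuous_sqrt.tendsto 0
    exact h.mono_left nhdsWithin_le_nhds
  · filter_upwards [self_mem_nhdsWithin] with x hx using sqrt_pos.2 hx

lemma tendsto_inv_sqrt_atTop : Tendsto (fun x : ℝ => (√x)⁻¹) atTop (𝓝 0) :=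
  tendsto_inv_atTop_zero.comp tendsto_sqrt_atTop

lemma tendsto_sqrt_div_nhdsGT_zero (μ : ℝ) :
    Tendsto (fun x : ℝ => √x / μ) (𝓝[>] 0) (𝓝 0) := by
  have h : Tendsto (fun x : ℝ => √x / μ) (𝓝 0) (𝓝 0) := by
    simpa using (continuous_sqrt.div_const μ).tendsto 0
  exact h.mono_left nhdsWithin_le_nhds

lemma tendsto_invGaussPdf_nhdsGT_zero {μ lam : ℝ} (hμ : 0 < μ) (hlam : 0 < lam) :
    Tendsto (invGaussPdf μ lam) (𝓝[>] 0) (𝓝 0) := by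
  have h := (((tendsto_rpow_mul_exp_neg_mul_atTop_nhds_zero 3 (lam / 2) (by positivity)).comp
    tendsto_inv_sqrt_nhdsGT_zero).const_mul (√(lam / 2 / π) * exp (lam / μ)))
  rw [mul_zero] at h
  refine squeeze_zero' (Eventually.of_forall fun x => invGaussPdf_nonneg _ _ x) ?_ h
  filter_upwards [self_mem_nhdsWithin,
    tendsto_inv_sqrt_nhdsGT_zero.eventually_ge_atTop 1] with x hx hv
  have hx : 0 < x := hx
  rw [invGaussPdf_eq hμ hlam hx]
  have hexp : exp (-(lam / 2) * (√x / μ - (√x)⁻¹) ^ 2) ≤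
      exp (lam / μ) * exp (-(lam / 2) * (√x)⁻¹) := by
    rw [← exp_add, exp_le_exp]
    have hcross : √x / μ * (√x)⁻¹ = 1 / μ := by
      have : 0 < √x := sqrt_pos.2 hx
      field_simp
    have hsq : (√x)⁻¹ - 2 * (1 / μ) ≤ (√x / μ - (√x)⁻¹) ^ 2 := by
      rw [← hcross]
      nlinarith [sq_nonneg (√x / μ)]
    have := mul_le_mul_of_nonneg_left hsq (half_pos hlam).le
    rw [show lam / μ = lam / 2 * (2 * (1 / μ)) by ring]
    linarith
  have h3 : (√x)⁻¹ ^ (3 : ℝ) = (√x)⁻¹ ^ 3 := by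
    exact_mod_cast rpow_natCast (√x)⁻¹ 3
  simp only [Function.comp_apply, h3]
  calc _ ≤ √(lam / 2 / π) * (√x)⁻¹ ^ 3 * (exp (lam / μ) * exp (-(lam / 2) * (√x)⁻¹)) := by gcongr
    _ = _ := by ring

lemma tendsto_invGaussPdf_atTop {μ lam : ℝ} (hμ : 0 < μ) (hlam : 0 < lam) :
    Tendsto (invGaussPdf μ lam) atTop (𝓝 0) := by
  have h := (tendsto_inv_sqrt_atTop.pow 3).const_mul √(lam / 2 / π)
  rw [zero_pow three_ne_zero, mul_zero] at h
  refine squeeze_zero' (Eventually.of_forall fun x => invGaussPdf_nonneg _ _ x) ?_ h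
  filter_upwards [eventually_gt_atTop 0] with x hx
  rw [invGaussPdf_eq hμ hlam hx]
  refine mul_le_of_le_one_right (by positivity) (exp_le_one_iff.2 ?_)
  rw [neg_mul]
  exact neg_nonpos.2 (by positivity)

/-- The inverse Gaussian distribution function, built from the normal one. -/
lemma exists_invGauss_primitive {μ lam : ℝ} (hμ : 0 < μ) (hlam : 0 < lam) :
    ∃ F : ℝ → ℝ, (∀ x > 0, HasDerivAt F (invGaussPdf μ lam x) x) ∧
      Tendsto F (𝓝[>] 0) (𝓝 0) ∧ Tendsto F atTop (𝓝 1) := by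
  obtain ⟨Φ, hΦ, hbot, htop⟩ := exists_gaussian_primitive (half_pos hlam)
  refine ⟨fun x => Φ (√x / μ - (√x)⁻¹) + exp (2 * lam / μ) * Φ (-(√x / μ) - (√x)⁻¹),
    fun x hx => ?_, ?_, ?_⟩
  · have hv := hasDerivAt_inv_sqrt hx
    have hs := (hasDerivAt_sqrt hx.ne').div_const μ
    convert! ((hΦ _).comp x (hs.sub hv)).add
      (((hΦ _).comp x (hs.neg.sub hv)).const_mul (exp (2 * lam / μ))) using 1
    rw [invGaussPdf_eq hμ hlam hx]
    simp only [Pi.sub_apply, Pi.neg_apply]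
    have hexp : exp (2 * lam / μ) * exp (-(lam / 2) * (-(√x / μ) - (√x)⁻¹) ^ 2) =
        exp (-(lam / 2) * (√x / μ - (√x)⁻¹) ^ 2) := by
      rw [← exp_add]
      congr 1
      have : 0 < √x := sqrt_pos.2 hx
      field_simp
      ring
    rw [← mul_assoc, mul_left_comm (exp (2 * lam / μ)), hexp]
    obtain ⟨r, hr, rfl⟩ : ∃ r, 0 < r ∧ x = r ^ 2 := ⟨√x, by positivity, (sq_sqrt hx.le).symm⟩
    rw [sqrt_sq hr.le]
    field_simp
    ring
  · have hs := tendsto_sqrt_div_nhdsGT_zero μ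
    have hv := tendsto_neg_atTop_atBot.comp tendsto_inv_sqrt_nhdsGT_zero
    have h1 := hbot.comp (hs.add_atBot hv)
    have h2 := hbot.comp (hs.neg.add_atBot hv)
    simpa [sub_eq_add_neg, Function.comp_def] using h1.add (h2.const_mul (exp (2 * lam / μ)))
  · have hs : Tendsto (fun x : ℝ => √x / μ) atTop atTop :=
      tendsto_sqrt_atTop.atTop_div_const hμ
    have hv := tendsto_inv_sqrt_atTop.neg
    have h1 := htop.comp (hs.atTop_add hv)
    have h2 := hbot.comp ((tendsto_neg_atTop_atBot.comp hs).atBot_add hv)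
    simpa [sub_eq_add_neg, Function.comp_def] using h1.add (h2.const_mul (exp (2 * lam / μ)))

lemma integral_sq_inv_sub_mul_invGaussPdf {μ lam α : ℝ} (hμ : 0 < μ) (hlam : 0 < lam)
    (hα : 0 ≤ α) :
    ∫ x in Ioi (0 : ℝ), (1 + α * (1 / x - 3 / (2 * lam)) ^ 2) * invGaussPdf μ lam x =
      1 + α * (1 / μ ^ 2 + 9 / (4 * lam ^ 2)) := by
  obtain ⟨F, hF, hF0, hF1⟩ := exists_invGauss_primitive hμ hlam
  set A := 1 + α * (1 / μ ^ 2 + 9 / (4 * lam ^ 2)) with hA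
  rw [integral_Ioi_zero_of_hasDerivAt_of_nonneg
    (G := fun x => A * F x + 2 * α / lam * invGaussPdf μ lam x) (l := 0) (m := A), sub_zero]
  · intro x hx
    convert! ((hF x hx).const_mul A).add
      ((hasDerivAt_invGaussPdf hμ hlam hx).const_mul (2 * α / lam)) using 1
    rw [hA]
    field_simp
    ring
  · intro x _
    exact mul_nonneg (by positivity) (invGaussPdf_nonneg _ _ _)
  · simpa using (hF0.const_mul A).add
      ((tendsto_invGaussPdf_nhdsGT_zero hμ hlam).const_mul (2 * α / lam))
  · simpa using (hF1.const_mul A).add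
      ((tendsto_invGaussPdf_atTop hμ hlam).const_mul (2 * α / lam))

lemma integral_sq_sub_mul_gammaPdf {c x : ℝ} (hc : 0 < c) (hx : 0 < x) (β M : ℝ) :
    ∫ y in Ioi (0 : ℝ), (1 + β * (y - M) ^ 2) * gammaPdf c x y =
      1 + β * (c * (c + 1) / x ^ 2 - 2 * M * (c / x) + M ^ 2) := by
  have key : ∀ k : ℝ, 0 < k →
      ∫ y in Ioi (0 : ℝ), y ^ (k - 1) * exp (-(x * y)) = (1 / x) ^ k * Gamma k :=
    fun k hk => integral_rpow_mul_exp_neg_mul_Ioi hk hx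
  have hint : ∀ k : ℝ, 0 < k →
      IntegrableOn (fun y : ℝ => y ^ (k - 1) * exp (-(x * y))) (Ioi 0) := fun k hk =>
    .of_integral_ne_zero (by
      rw [key k hk]
      exact (mul_pos (by positivity) (Gamma_pos_of_pos hk)).ne')
  have hG : Gamma c ≠ 0 := (Gamma_pos_of_pos hc).ne'
  have hxc : x ^ c ≠ 0 := (rpow_pos_of_pos hx c).ne'
  set K := x ^ c / Gamma c with hK
  have hcongr : ∀ y ∈ Ioi (0 : ℝ), (1 + β * (y - M) ^ 2) * gammaPdf c x y =
      K * (1 + β * M ^ 2) * (y ^ (c - 1) * exp (-(x * y))) +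
      K * (-2 * β * M) * (y ^ (c + 1 - 1) * exp (-(x * y))) +
      K * β * (y ^ (c + 2 - 1) * exp (-(x * y))) := by
    intro y (hy : 0 < y)
    rw [gammaPdf, hK, show c + 1 - 1 = c - 1 + 1 by ring, show c + 2 - 1 = c - 1 + 2 by ring,
      rpow_add hy, rpow_add hy, rpow_one, rpow_two]
    ring
  have h0 := (hint c hc).const_mul (K * (1 + β * M ^ 2))
  have h1 := (hint (c + 1) (by positivity)).const_mul (K * (-2 * β * M))
  have h2 := (hint (c + 2) (by positivity)).const_mul (K * β)
  rw [setIntegral_congr_fun measurableSet_Ioi hcongr, integral_add (h0.fun_add h1) h2,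
    integral_add h0 h1, integral_const_mul, integral_const_mul, integral_const_mul,
    key c hc, key (c + 1) (by positivity), key (c + 2) (by positivity),
    show c + 2 = c + 1 + 1 by ring, Gamma_add_one (by positivity : c + 1 ≠ 0),
    Gamma_add_one hc.ne', rpow_add_one (by positivity), rpow_add_one (by positivity),
    rpow_add_one (by positivity), one_div, inv_rpow hx.le, hK]
  field_simp
  ring

/-- The geometric drift conditions verifying Theorem 3.5 of Johnson and Jones, which
establish geometric ergodicity of the data-augmented Gibbs sampler for the GIG
(case p < -1/2, Proposition 3). -/
theorem gig_gibbs_drift_neg (p a b α β : ℝ) (hp : p < -(1/2 : ℝ)) (ha : 0 < a) (hb : 0 < b)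
    (hα0 : 0 < α) (hα1 : α < b ^ 2 / (p ^ 2 - 1/4))
    (hβ0 : α ^ 2 / b ^ 2 ≤ β) (hβ1 : β < α / (p ^ 2 - 1/4)) :
    (∀ y > (0 : ℝ),
        (∫ x in Ioi (0 : ℝ),
            (1 + α * (1 / x - 3 / (2 * b)) ^ 2) *
              invGaussPdf (Real.sqrt (b / (a + 2 * y))) b x)
          ≤ (1 + β * (y - 3 * (1/2 - p) / (2 * b)) ^ 2) +
              (1 + 9 * α / (4 * b ^ 2) + α * a / b +
                2 * α * (3 * (1/2 - p) / (2 * b)) / b)) ∧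
    (∀ x > (0 : ℝ),
        (∫ y in Ioi (0 : ℝ),
            (1 + β * (y - 3 * (1/2 - p) / (2 * b)) ^ 2) * gammaPdf (-(p + 1/2)) x y)
          ≤ (β * (p ^ 2 - 1/4) / α) * (1 + α * (1 / x - 3 / (2 * b)) ^ 2) +
              (1 + 9 * β * (1/2 - p) / (4 * b ^ 2))) ∧
    (0 < β * (p ^ 2 - 1/4) / α ∧ β * (p ^ 2 - 1/4) / α < 1) := by
  have hc : 0 < -(p + 1 / 2) := by linarith
  have hp2 : 0 < p ^ 2 - 1 / 4 := by nlinarith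
  have hβ : 0 < β := lt_of_lt_of_le (by positivity) hβ0
  refine ⟨fun y hy => ?_, fun x hx => ?_, by positivity, ?_⟩
  · rw [integral_sq_inv_sub_mul_invGaussPdf (by positivity) hb hα0.le,
      sq_sqrt (by positivity), one_div_div]
    generalize 3 * (1 / 2 - p) / (2 * b) = M
    have hsq := mul_le_mul_of_nonneg_right hβ0 (sq_nonneg (y - M))
    have hkey : 2 * (α * (y - M) / b) ≤ 1 + α ^ 2 / b ^ 2 * (y - M) ^ 2 := by
      have h := two_mul_le_add_sq 1 (α * (y - M) / b)
      rw [div_pow, mul_pow] at h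
      linarith [mul_div_right_comm (α ^ 2) ((y - M) ^ 2) (b ^ 2)]
    have hexpand : 1 + α * ((a + 2 * y) / b + 9 / (4 * b ^ 2)) =
        1 + 9 * α / (4 * b ^ 2) + α * a / b + 2 * α * M / b + 2 * (α * (y - M) / b) := by ring
    linarith
  · rw [integral_sq_sub_mul_gammaPdf hc hx]
    have hm : 0 ≤ β * (p ^ 2 - 1 / 4) / α := by positivity
    refine le_of_sub_nonneg (hm.trans_eq ?_)
    field_simp
    ring
  · rw [div_lt_one hα0]
    exact (lt_div_iff₀ hp2).1 hβ1
end
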